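/- Final number of edges in the reverse H-free process. Let H be a 2-balanced graph. There are constants a, A > 0 (depending only on H) such that the final number of edges M_n of the reverse H-free process on n vertices has expectation satisfying a·n^{2−1/d_2(H)} ≤ E M_n ≤ A·n^{2−1/d_2(H)}. Furthermore, for every c > 0 there exists n_0 = n_0(c,H) such that for all n ≥ n_0, |M_n − E M_n| ≤ √(E M_n)·(log n)^{4e_H} holds with probability at least 1 − n^{−c}. -/

import Mathlib

open scoped ENNReal

noncomputable def prOf {α : Type*} (μ : PMF α) (E : Set α) : ℝ≥0∞ :=
  ∑' x : E, μ x

/-- `d_2(H) = (e_H - 1)/(v_H - 2)`. -/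
noncomputable def d2 {β : Type*} [Fintype β] (H : SimpleGraph β) : ℝ :=
  ((H.edgeSet.ncard : ℝ) - 1) / ((Fintype.card β : ℝ) - 2)

/-- `H` is 2-balanced: `e_H ≥ 2` and every proper subgraph `G ⊊ H` with at least 3
vertices satisfies `(e_G - 1)/(v_G - 2) ≤ d_2(H)`. -/
def TwoBalanced {β : Type*} [Fintype β] (H : SimpleGraph β) : Prop :=
  2 ≤ H.edgeSet.ncard ∧
    ∀ G : H.Subgraph, G ≠ ⊤ → 3 ≤ G.verts.ncard →
      ((G.edgeSet.ncard : ℝ) - 1) / ((G.verts.ncard : ℝ) - 2) ≤ d2 H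

/-- The edge set `E` contains a copy of `H` using the edge `e`. -/
def copyAt {β V : Type*} (H : SimpleGraph β) (E : Set (Sym2 V)) (e : Sym2 V) : Prop :=
  ∃ φ : β ↪ V, (∀ a b, H.Adj a b → s(φ a, φ b) ∈ E) ∧ ∃ a b, H.Adj a b ∧ e = s(φ a, φ b)

/-- The edges of `E` that are contained in a copy of `H` inside `E`. -/
noncomputable def removable {β : Type*} {n : ℕ} (H : SimpleGraph β)
    (E : Finset (Sym2 (Fin n))) : Finset (Sym2 (Fin n)) :=
  @Finset.filter _ (fun e => copyAt H (↑E) e) (Classical.decPred _) E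

/-- `fuel` steps of the reverse `H`-free process: as long as some edge lies in a copy of
`H`, a uniformly random such edge is removed. -/
noncomputable def reverseIter {β : Type*} {n : ℕ} (H : SimpleGraph β) :
    ℕ → Finset (Sym2 (Fin n)) → PMF (Finset (Sym2 (Fin n)))
  | 0, E => PMF.pure E
  | fuel + 1, E =>
    if h : (removable H E).Nonempty then
      (PMF.uniformOfFinset (removable H E) h).bind
        (fun e => reverseIter H fuel (E.erase e))
    else PMF.pure E

/-- All edges of the complete graph `K_n` on `Fin n`. -/
def allEdges (n : ℕ) : Finset (Sym2 (Fin n)) :=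
  Finset.univ.filter (fun e => ¬ e.IsDiag)

/-- The law of the final graph (edge set) of the reverse `H`-free process on `n`
vertices; since each step removes one edge, `(allEdges n).card` steps always suffice. -/
noncomputable def reverseFinal {β : Type*} (H : SimpleGraph β) (n : ℕ) :
    PMF (Finset (Sym2 (Fin n))) :=
  reverseIter H ((allEdges n).card) (allEdges n)

/-- The expected number of edges of a random graph (edge set). -/
noncomputable def expEdges {n : ℕ} (q : PMF (Finset (Sym2 (Fin n)))) : ℝ :=
  ∑' s, (q s).toReal * (s.card : ℝ)

section Prob
set_option linter.unusedSectionVars false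
open Finset
open scoped Classical

variable {α : Type*} [Fintype α]

/-- Expectation over uniform i.i.d. sequences of length `m`. -/
noncomputable def Ex (m : ℕ) (F : (Fin m → α) → ℝ) : ℝ :=
  (∑ ω, F ω) / (Fintype.card α : ℝ) ^ m

/-- Probability over uniform i.i.d. sequences of length `m`. -/
noncomputable def Pr (m : ℕ) (Q : (Fin m → α) → Prop) : ℝ :=
  Ex m (fun ω => if Q ω then (1 : ℝ) else 0)

lemma Ex_mono {m : ℕ} {F G : (Fin m → α) → ℝ} (h : ∀ ω, F ω ≤ G ω) : Ex m F ≤ Ex m G := by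
  unfold Ex
  gcongr with ω
  exact h ω

lemma Ex_add {m : ℕ} (F G : (Fin m → α) → ℝ) :
    Ex m (fun ω => F ω + G ω) = Ex m F + Ex m G := by
  unfold Ex
  rw [sum_add_distrib, add_div]

lemma Ex_sub {m : ℕ} (F G : (Fin m → α) → ℝ) :
    Ex m (fun ω => F ω - G ω) = Ex m F - Ex m G := by
  unfold Ex
  rw [sum_sub_distrib, sub_div]

lemma Ex_mul {m : ℕ} (c : ℝ) (F : (Fin m → α) → ℝ) :
    Ex m (fun ω => c * F ω) = c * Ex m F := by
  unfold Ex
  rw [← mul_sum, mul_div_assoc]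

lemma Ex_const {m : ℕ} [Nonempty α] (c : ℝ) :
    Ex m (fun _ : Fin m → α => c) = c := by
  unfold Ex
  have : (Fintype.card α : ℝ) ≠ 0 := by exact_mod_cast Fintype.card_ne_zero
  simp [this]

lemma Ex_nonneg {m : ℕ} {F : (Fin m → α) → ℝ} (h : ∀ ω, 0 ≤ F ω) : 0 ≤ Ex m F := by
  unfold Ex
  exact div_nonneg (sum_nonneg fun ω _ => h ω) (by positivity)

lemma Ex_sum {m : ℕ} {ι : Type*} (s : Finset ι) (F : ι → (Fin m → α) → ℝ) :
    Ex m (fun ω => ∑ i ∈ s, F i ω) = ∑ i ∈ s, Ex m (F i) := by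
  unfold Ex
  rw [sum_comm, sum_div]

lemma Ex_div {m : ℕ} (c : ℝ) (F : (Fin m → α) → ℝ) :
    Ex m (fun ω => F ω / c) = Ex m F / c := by
  unfold Ex
  rw [← sum_div, div_right_comm]

lemma Ex_abs {m : ℕ} (F : (Fin m → α) → ℝ) : |Ex m F| ≤ Ex m (fun ω => |F ω|) := by
  rw [abs_le]
  constructor
  · have : - Ex m (fun ω => |F ω|) = Ex m (fun ω => (-1) * |F ω|) := by rw [Ex_mul]; ring
    rw [this]
    exact Ex_mono fun ω => by linarith [neg_abs_le (F ω)]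
  · exact Ex_mono fun ω => le_abs_self _

lemma sum_snoc {m : ℕ} (F : (Fin (m + 1) → α) → ℝ) :
    ∑ ω, F ω = ∑ ω : Fin m → α, ∑ e, F (Fin.snoc ω e) := by
  rw [sum_comm, ← Fintype.sum_prod_type', ← (Fin.snocEquiv (fun _ : Fin (m + 1) => α)).sum_comp]
  rfl

lemma sum_append {m k : ℕ} (F : (Fin (m + k) → α) → ℝ) :
    ∑ ω, F ω = ∑ ω : Fin m → α, ∑ ω' : Fin k → α, F (Fin.append ω ω') := by
  rw [← Fintype.sum_prod_type', ← (Fin.appendEquiv (α := α) m k).sum_comp]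
  rfl

lemma Ex_succ {m : ℕ} (F : (Fin (m + 1) → α) → ℝ) :
    Ex (m + 1) F = Ex m (fun ω => (∑ e, F (Fin.snoc ω e)) / (Fintype.card α : ℝ)) := by
  unfold Ex
  rw [sum_snoc, ← sum_div, div_div, pow_succ']

lemma Ex_append {m k : ℕ} (F : (Fin (m + k) → α) → ℝ) :
    Ex (m + k) F = Ex m (fun ω => Ex k (fun ω' => F (Fin.append ω ω'))) := by
  unfold Ex
  rw [sum_append, ← sum_div, div_div, pow_add, mul_comm]

lemma Pr_mono {m : ℕ} {P Q : (Fin m → α) → Prop} (h : ∀ ω, P ω → Q ω) : Pr m P ≤ Pr m Q := by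
  refine Ex_mono fun ω => ?_
  by_cases hp : P ω
  · simp [hp, h ω hp]
  · simp only [hp, if_false]; split_ifs <;> norm_num

lemma Pr_nonneg {m : ℕ} (P : (Fin m → α) → Prop) : 0 ≤ Pr m P :=
  Ex_nonneg fun ω => by split_ifs <;> norm_num

lemma Pr_le_one {m : ℕ} [Nonempty α] (P : (Fin m → α) → Prop) : Pr m P ≤ 1 := by
  rw [← Ex_const (α := α) (m := m) 1]
  exact Ex_mono fun ω => by split_ifs <;> norm_num

lemma Pr_or {m : ℕ} (P Q : (Fin m → α) → Prop) :
    Pr m (fun ω => P ω ∨ Q ω) ≤ Pr m P + Pr m Q := by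
  unfold Pr
  rw [← Ex_add]
  refine Ex_mono fun ω => ?_
  by_cases hp : P ω <;> by_cases hq : Q ω <;> simp [hp, hq]

lemma Pr_exists {m : ℕ} {ι : Type*} [Fintype ι] (P : ι → (Fin m → α) → Prop) :
    Pr m (fun ω => ∃ i, P i ω) ≤ ∑ i, Pr m (P i) := by
  unfold Pr
  rw [← Ex_sum]
  refine Ex_mono fun ω => ?_
  split_ifs with h
  · obtain ⟨i, hi⟩ := h
    refine le_trans ?_ (single_le_sum (f := fun i => if P i ω then (1 : ℝ) else 0) ?_ (mem_univ i))
    · simp [hi]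
    · intro j _; split_ifs <;> norm_num
  · exact sum_nonneg fun j _ => by split_ifs <;> norm_num

lemma Pr_compl {m : ℕ} [Nonempty α] (P : (Fin m → α) → Prop) :
    Pr m (fun ω => ¬ P ω) = 1 - Pr m P := by
  unfold Pr
  rw [← Ex_const (α := α) (m := m) 1, ← Ex_sub, Ex_const]
  congr 1
  ext ω
  by_cases hp : P ω <;> simp [hp]

lemma markov {m : ℕ} (F : (Fin m → α) → ℝ) (hF : ∀ ω, 0 ≤ F ω) (t : ℝ) (ht : 0 < t) :
    Pr m (fun ω => t ≤ F ω) ≤ Ex m F / t := by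
  rw [← Ex_div]
  refine Ex_mono fun ω => ?_
  split_ifs with h
  · rwa [le_div_iff₀ ht, one_mul]
  · exact div_nonneg (hF ω) ht.le

/-- second moment method -/
lemma second_moment {m : ℕ} (F : (Fin m → α) → ℝ) (hF : ∀ ω, 0 ≤ F ω) :
    (Ex m F) ^ 2 ≤ Ex m (fun ω => F ω ^ 2) * Pr m (fun ω => 0 < F ω) := by
  unfold Pr Ex
  rw [div_pow, div_mul_div_comm, ← sq]
  gcongr
  have := sum_mul_sq_le_sq_mul_sq univ F (fun ω => if 0 < F ω then (1 : ℝ) else 0)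
  convert this using 3 with ω _ ω _
  · by_cases h : 0 < F ω
    · simp [h]
    · simp [h]; exact le_antisymm (not_lt.1 h) (hF ω)
  · simp

lemma exp_le_cosh (s X c : ℝ) (hc : 0 < c) (h : |X| ≤ c) :
    Real.exp (s * X) ≤ Real.cosh (s * c) + X / c * Real.sinh (s * c) := by
  have hX := abs_le.1 h
  have hcv := convexOn_exp.2
  have := @hcv (s * c) (Set.mem_univ _) (-(s * c)) (Set.mem_univ _)
    ((c + X) / (2 * c)) ((c - X) / (2 * c))
    (div_nonneg (by linarith) (by linarith)) (div_nonneg (by linarith) (by linarith))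
    (by field_simp; ring)
  simp only [smul_eq_mul] at this
  rw [show (c + X) / (2 * c) * (s * c) + (c - X) / (2 * c) * -(s * c) = s * X by
    field_simp; ring] at this
  refine this.trans (le_of_eq ?_)
  rw [Real.cosh_eq, Real.sinh_eq]
  field_simp
  ring

lemma hamming_snoc {m : ℕ} (x y : Fin m → α) (e : α) :
    hammingDist (Fin.snoc x e : Fin (m + 1) → α) (Fin.snoc y e) = hammingDist x y := by
  unfold hammingDist
  have : (univ.filter fun i => (Fin.snoc x e : Fin (m + 1) → α) i ≠
      (Fin.snoc y e : Fin (m + 1) → α) i) =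
      (univ.filter fun i => x i ≠ y i).map Fin.castSuccEmb := by
    ext i
    refine Fin.lastCases ?_ (fun i => ?_) i <;> simp
  rw [this, card_map]

lemma hamming_snoc' {m : ℕ} (x : Fin m → α) (e e' : α) :
    hammingDist (Fin.snoc x e : Fin (m + 1) → α) (Fin.snoc x e') ≤ 1 := by
  unfold hammingDist
  refine (card_le_card (t := {Fin.last m}) ?_).trans (by simp)
  intro i
  refine Fin.lastCases ?_ (fun i => ?_) i <;> simp

/-- Exponential moment bound for Lipschitz functions of independent coordinates. -/
lemma mgf_bound [Nonempty α] (s c : ℝ) (hc : 0 < c) : ∀ (m : ℕ) (g : (Fin m → α) → ℝ),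
    (∀ x y, |g x - g y| ≤ c * hammingDist x y) →
    Ex m (fun ω => Real.exp (s * (g ω - Ex m g))) ≤ Real.exp (m * (s ^ 2 * c ^ 2 / 2)) := by
  intro m
  have hN : (0 : ℝ) < Fintype.card α := by exact_mod_cast Fintype.card_pos
  induction m with
  | zero =>
    intro g _
    have : ∀ ω : Fin 0 → α, ω = default := fun ω => Subsingleton.elim _ _
    simp [Ex]
  | succ m ih =>
    intro g hg
    set g' : (Fin m → α) → ℝ := fun ω => (∑ e, g (Fin.snoc ω e)) / (Fintype.card α : ℝ) with hg'
    have hE : Ex (m + 1) g = Ex m g' := Ex_succ g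
    have hlip : ∀ x y, |g' x - g' y| ≤ c * hammingDist x y := by
      intro x y
      simp only [hg']
      rw [← sub_div, ← sum_sub_distrib, abs_div, abs_of_pos hN, div_le_iff₀ hN]
      refine (abs_sum_le_sum_abs _ _).trans ?_
      refine (sum_le_card_nsmul _ _ (c * hammingDist x y) ?_).trans ?_
      · intro e _
        have := hg (Fin.snoc x e) (Fin.snoc y e)
        rwa [hamming_snoc] at this
      · simp [mul_comm]
    have hdev : ∀ ω e, |g (Fin.snoc ω e) - g' ω| ≤ c := by
      intro ω e
      have : g (Fin.snoc ω e) - g' ω =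
          (∑ e', (g (Fin.snoc ω e) - g (Fin.snoc ω e'))) / (Fintype.card α : ℝ) := by
        simp only [hg', sum_sub_distrib, sum_const, card_univ, nsmul_eq_mul]
        field_simp
      rw [this, abs_div, abs_of_pos hN, div_le_iff₀ hN]
      refine (abs_sum_le_sum_abs _ _).trans ?_
      refine (sum_le_card_nsmul _ _ c ?_).trans ?_
      · intro e' _
        refine (hg _ _).trans ?_
        have h1 : (hammingDist (Fin.snoc ω e : Fin (m + 1) → α) (Fin.snoc ω e') : ℝ) ≤ 1 := by
          exact_mod_cast hamming_snoc' ω e e'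
        nlinarith
      · simp [mul_comm]
    have hzero : ∀ ω, ∑ e, (g (Fin.snoc ω e) - g' ω) = 0 := by
      intro ω
      simp only [hg', sum_sub_distrib, sum_const, card_univ, nsmul_eq_mul]
      field_simp
      ring
    rw [Ex_succ, hE]
    have key : ∀ ω, (∑ e, Real.exp (s * (g (Fin.snoc ω e) - Ex m g'))) / (Fintype.card α : ℝ) ≤
        Real.exp (s ^ 2 * c ^ 2 / 2) * Real.exp (s * (g' ω - Ex m g')) := by
      intro ω
      rw [div_le_iff₀ hN]
      have h1 : ∀ e, Real.exp (s * (g (Fin.snoc ω e) - Ex m g')) ≤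
          (Real.cosh (s * c) + (g (Fin.snoc ω e) - g' ω) / c * Real.sinh (s * c)) *
          Real.exp (s * (g' ω - Ex m g')) := by
        intro e
        rw [show s * (g (Fin.snoc ω e) - Ex m g') =
          s * (g (Fin.snoc ω e) - g' ω) + s * (g' ω - Ex m g') by ring, Real.exp_add]
        gcongr
        exact exp_le_cosh _ _ _ hc (hdev ω e)
      refine (sum_le_sum fun e _ => h1 e).trans ?_
      rw [← sum_mul, sum_add_distrib, ← sum_mul, ← sum_div, hzero]
      simp only [sum_const, card_univ, nsmul_eq_mul, zero_div, zero_mul, add_zero]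
      have := Real.cosh_le_exp_half_sq (s * c)
      rw [mul_pow] at this
      calc (Fintype.card α : ℝ) * Real.cosh (s * c) * Real.exp (s * (g' ω - Ex m g'))
          ≤ (Fintype.card α : ℝ) * Real.exp (s ^ 2 * c ^ 2 / 2)
            * Real.exp (s * (g' ω - Ex m g')) := by gcongr
        _ = _ := by ring
    refine (Ex_mono key).trans ?_
    rw [Ex_mul]
    refine (mul_le_mul_of_nonneg_left (ih g' hlip) (Real.exp_pos _).le).trans ?_
    rw [← Real.exp_add]
    apply le_of_eq
    congr 1
    push_cast
    ring

lemma mcdiarmid_upper [Nonempty α] (c : ℝ) (hc : 0 < c) (m : ℕ) (hm : 0 < m)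
    (g : (Fin m → α) → ℝ)
    (hg : ∀ x y, |g x - g y| ≤ c * hammingDist x y) (t : ℝ) (ht : 0 ≤ t) :
    Pr m (fun ω => t ≤ g ω - Ex m g) ≤ Real.exp (-(t ^ 2 / (2 * m * c ^ 2))) := by
  have hm' : (0 : ℝ) < m := by exact_mod_cast hm
  set s : ℝ := t / (m * c ^ 2) with hs
  have hs0 : 0 ≤ s := by positivity
  have h1 : Pr m (fun ω => t ≤ g ω - Ex m g) ≤
      Pr m (fun ω => Real.exp (s * t) ≤ Real.exp (s * (g ω - Ex m g))) := by
    refine Pr_mono fun ω h => ?_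
    rw [Real.exp_le_exp]
    gcongr
  refine h1.trans ((markov _ (fun ω => (Real.exp_pos _).le) _ (Real.exp_pos _)).trans ?_)
  rw [div_le_iff₀ (Real.exp_pos _), ← Real.exp_add]
  refine (mgf_bound s c hc m g hg).trans (le_of_eq ?_)
  congr 1
  rw [hs]
  field_simp
  ring

lemma mcdiarmid [Nonempty α] (c : ℝ) (hc : 0 < c) (m : ℕ) (hm : 0 < m)
    (g : (Fin m → α) → ℝ)
    (hg : ∀ x y, |g x - g y| ≤ c * hammingDist x y) (t : ℝ) (ht : 0 ≤ t) :
    Pr m (fun ω => t ≤ |g ω - Ex m g|) ≤ 2 * Real.exp (-(t ^ 2 / (2 * m * c ^ 2))) := by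
  have h1 := mcdiarmid_upper c hc m hm g hg t ht
  have h2 := mcdiarmid_upper c hc m hm (fun ω => (-1) * g ω) (fun x y => by
    have := hg x y
    rwa [show (-1) * g x - (-1) * g y = -(g x - g y) by ring, abs_neg]) t ht
  rw [Ex_mul] at h2
  have h3 : Pr m (fun ω => t ≤ |g ω - Ex m g|) ≤
      Pr m (fun ω => t ≤ g ω - Ex m g ∨ t ≤ -1 * g ω - -1 * Ex m g) := by
    refine Pr_mono fun ω h => ?_
    rcases le_abs.1 h with h | h
    · left; exact h
    · right; linarith
  linarith [h3.trans (Pr_or _ _)]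

/-- Concentration when the Lipschitz condition holds relative to typical points. -/
lemma typical_mcdiarmid [Nonempty α] (c : ℝ) (hc : 0 < c) (m : ℕ) (hm : 0 < m)
    (f : (Fin m → α) → ℝ) (Γ : (Fin m → α) → Prop) (B : ℝ)
    (hB : ∀ x, 0 ≤ f x ∧ f x ≤ B)
    (hf : ∀ x y, Γ y → f x ≤ f y + c * hammingDist x y) (t : ℝ) (ht : 0 ≤ t)
    (hΓ : (B + c * m) * Pr m (fun ω => ¬ Γ ω) ≤ 1) (hΓ' : ∃ y, Γ y) :
    Pr m (fun ω => t + 1 ≤ |f ω - Ex m f|) ≤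
      2 * Real.exp (-(t ^ 2 / (2 * m * c ^ 2))) + Pr m (fun ω => ¬ Γ ω) := by
  set S : Finset (Fin m → α) := univ.filter Γ with hS
  have hSne : S.Nonempty := by
    obtain ⟨y, hy⟩ := hΓ'
    exact ⟨y, by simp [hS, hy]⟩
  set g : (Fin m → α) → ℝ := fun x => S.inf' hSne (fun y => f y + c * hammingDist x y) with hgdef
  have hfg : ∀ x, f x ≤ g x := by
    intro x
    rw [hgdef]
    refine le_inf' _ _ fun y hy => ?_
    exact hf x y (by simpa [hS] using hy)
  have hgf : ∀ x, Γ x → g x = f x := by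
    intro x hx
    refine le_antisymm ?_ (hfg x)
    have := inf'_le (fun y => f y + c * (hammingDist x y : ℝ)) (show x ∈ S by simp [hS, hx])
    simpa using this
  have hlip1 : ∀ x y, g x ≤ g y + c * hammingDist x y := by
    intro x y
    obtain ⟨z, hz, hz'⟩ := exists_mem_eq_inf' hSne (fun z => f z + c * (hammingDist y z : ℝ))
    have h1 : g x ≤ f z + c * hammingDist x z := inf'_le _ hz
    have h2 : g y = f z + c * hammingDist y z := hz'
    have h3 : (hammingDist x z : ℝ) ≤ hammingDist x y + hammingDist y z := by
      exact_mod_cast hammingDist_triangle x y z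
    nlinarith
  have hlip : ∀ x y, |g x - g y| ≤ c * hammingDist x y := by
    intro x y
    rw [abs_le]
    have h1 := hlip1 x y
    have h2 := hlip1 y x
    rw [hammingDist_comm] at h2
    constructor <;> linarith
  have hgB : ∀ x, g x ≤ B + c * m := by
    intro x
    obtain ⟨z, hz⟩ := hSne
    have h1 : g x ≤ f z + c * hammingDist x z := inf'_le _ hz
    have h2 : (hammingDist x z : ℝ) ≤ m := by
      have := hammingDist_le_card_fintype (x := x) (y := z)
      rw [Fintype.card_fin] at this
      exact_mod_cast this
    have := (hB z).2
    nlinarith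
  have hE1 : Ex m f ≤ Ex m g := Ex_mono hfg
  have hE2 : Ex m g ≤ Ex m f + 1 := by
    have : Ex m g - Ex m f ≤ (B + c * m) * Pr m (fun ω => ¬ Γ ω) := by
      rw [← Ex_sub]
      unfold Pr
      rw [← Ex_mul]
      refine Ex_mono fun ω => ?_
      by_cases h : Γ ω
      · simp [h, hgf ω h]
      · simp only [h, not_false_eq_true, if_true, mul_one]
        linarith [hgB ω, (hB ω).1]
    linarith
  have h3 : Pr m (fun ω => t + 1 ≤ |f ω - Ex m f|) ≤
      Pr m (fun ω => t ≤ |g ω - Ex m g| ∨ ¬ Γ ω) := by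
    refine Pr_mono fun ω h => ?_
    by_cases hG : Γ ω
    · left
      rw [hgf ω hG]
      rcases le_abs.1 h with h | h
      · exact le_abs.2 (Or.inl (by linarith))
      · exact le_abs.2 (Or.inr (by linarith))
    · right; exact hG
  linarith [h3.trans (Pr_or _ _), mcdiarmid c hc m hm g hlip t ht]

end Prob

section Hyper
set_option linter.unusedSectionVars false
open Finset
open scoped Classical

variable {α : Type*} [Fintype α]

lemma Pr_def {m : ℕ} (Q : (Fin m → α) → Prop) [DecidablePred Q] :
    Pr m Q = Ex m (fun ω => if Q ω then (1 : ℝ) else 0) := by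
  unfold Pr
  congr 1
  ext ω
  congr

/-- The set of values of a sequence. -/
noncomputable def rng {m : ℕ} (ω : Fin m → α) : Finset α := univ.image ω

lemma rng_snoc {m : ℕ} (ω : Fin m → α) (e : α) :
    rng (Fin.snoc ω e : Fin (m + 1) → α) = insert e (rng ω) := by
  ext x
  simp only [rng, mem_image, mem_univ, true_and, mem_insert]
  constructor
  · rintro ⟨i, rfl⟩
    refine Fin.lastCases ?_ (fun i => ?_) i
    · simp
    · right; exact ⟨i, by simp⟩
  · rintro (rfl | ⟨i, rfl⟩)
    · exact ⟨Fin.last m, by simp⟩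
    · exact ⟨i.castSucc, by simp⟩

lemma rng_append {m k : ℕ} (ω : Fin m → α) (ω' : Fin k → α) :
    rng (Fin.append ω ω') = rng ω ∪ rng ω' := by
  ext x
  simp only [rng, mem_image, mem_univ, true_and, mem_union]
  constructor
  · rintro ⟨i, rfl⟩
    refine Fin.addCases (fun i => ?_) (fun i => ?_) i
    · left; exact ⟨i, by simp⟩
    · right; exact ⟨i, by simp⟩
  · rintro (⟨i, rfl⟩ | ⟨i, rfl⟩)
    · exact ⟨Fin.castAdd k i, by simp⟩
    · exact ⟨Fin.natAdd m i, by simp⟩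

lemma Pr_append_le {m k : ℕ} (R : (Fin (m + k) → α) → Prop) (P : (Fin m → α) → Prop)
    (Q : (Fin k → α) → Prop) (h : ∀ ω ω', R (Fin.append ω ω') → P ω ∧ Q ω') :
    Pr (m + k) R ≤ Pr m P * Pr k Q := by
  have : Pr m P * Pr k Q = Ex m (fun ω => Ex k (fun ω' =>
      (if P ω then (1 : ℝ) else 0) * (if Q ω' then (1 : ℝ) else 0))) := by
    simp_rw [Ex_mul]
    simp_rw [mul_comm _ (Ex k _)]
    rw [Ex_mul, mul_comm]
    rfl
  rw [this, Pr, Ex_append]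
  refine Ex_mono fun ω => Ex_mono fun ω' => ?_
  by_cases hR : R (Fin.append ω ω')
  · have := h _ _ hR
    simp [hR, this.1, this.2]
  · simp only [hR, if_false]
    split_ifs <;> norm_num

lemma Pr_append_ge {m k : ℕ} (R : (Fin (m + k) → α) → Prop) (P : (Fin m → α) → Prop)
    (Q : (Fin k → α) → Prop) (h : ∀ ω ω', P ω → Q ω' → R (Fin.append ω ω')) :
    Pr m P * Pr k Q ≤ Pr (m + k) R := by
  have : Pr m P * Pr k Q = Ex m (fun ω => Ex k (fun ω' =>
      (if P ω then (1 : ℝ) else 0) * (if Q ω' then (1 : ℝ) else 0))) := by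
    simp_rw [Ex_mul]
    simp_rw [mul_comm _ (Ex k _)]
    rw [Ex_mul, mul_comm]
    rfl
  rw [this, Pr, Ex_append]
  refine Ex_mono fun ω => Ex_mono fun ω' => ?_
  by_cases hP : P ω
  · by_cases hQ : Q ω'
    · simp [hP, hQ, h _ _ hP hQ]
    · simp only [hQ, if_false, mul_zero]; split_ifs <;> norm_num
  · simp only [hP, if_false, zero_mul]; split_ifs <;> norm_num

lemma pow_add_lower (a b : ℝ) (ha : 0 ≤ a) (hb : 0 ≤ b) (s : ℕ) :
    a ^ s + s * b * a ^ (s - 1) ≤ (a + b) ^ s := by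
  induction s with
  | zero => simp
  | succ s ih =>
    rcases Nat.eq_zero_or_pos s with rfl | hs
    · simp
    · have h1 : a ^ s = a * a ^ (s - 1) := by
        rw [← pow_succ']; congr 1; omega
      have h2 : (0 : ℝ) ≤ a ^ (s - 1) := by positivity
      have h3 : (0 : ℝ) ≤ s * b * a ^ (s - 1) := by positivity
      have := mul_le_mul_of_nonneg_right ih (add_nonneg ha hb)
      rw [pow_succ (a + b)]
      refine le_trans ?_ this
      simp only [Nat.add_sub_cancel]
      push_cast
      rw [pow_succ, h1]
      nlinarith [mul_nonneg h3 hb]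

lemma Pr_subset_le [Nonempty α] (m : ℕ) : ∀ S : Finset α,
    Pr m (fun ω => S ⊆ rng ω) ≤ ((m : ℝ) / Fintype.card α) ^ S.card := by
  have hN : (0 : ℝ) < Fintype.card α := by exact_mod_cast Fintype.card_pos
  induction m with
  | zero =>
    intro S
    rcases S.eq_empty_or_nonempty with rfl | hS
    · simpa using Pr_le_one _
    · have : ∀ ω : Fin 0 → α, ¬ S ⊆ rng ω := by
        intro ω h
        obtain ⟨a, ha⟩ := hS
        have := h ha
        simp [rng] at this
      simp only [Pr, this, if_false]
      rw [Ex_const]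
      positivity
  | succ m ih =>
    intro S
    have key : ∀ ω : Fin m → α, (∑ e, if S ⊆ rng (Fin.snoc ω e : Fin (m + 1) → α) then (1 : ℝ) else 0)
        / (Fintype.card α : ℝ) ≤ (if S ⊆ rng ω then (1 : ℝ) else 0) +
          (∑ e ∈ S, if S.erase e ⊆ rng ω then (1 : ℝ) else 0) / (Fintype.card α : ℝ) := by
      intro ω
      rw [div_le_iff₀ hN, add_mul, div_mul_cancel₀ _ hN.ne']
      have h1 : (∑ e ∈ S, if S.erase e ⊆ rng ω then (1 : ℝ) else 0) =
          ∑ e, if e ∈ S ∧ S.erase e ⊆ rng ω then (1 : ℝ) else 0 := by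
        rw [← sum_filter, ← sum_filter]
        apply sum_congr _ (fun _ _ => rfl)
        ext; simp
      have h2 : (if S ⊆ rng ω then (1 : ℝ) else 0) * (Fintype.card α : ℝ) =
          ∑ e : α, if S ⊆ rng ω then (1 : ℝ) else 0 := by
        simp
      rw [h1, h2, ← sum_add_distrib]
      refine sum_le_sum fun e _ => ?_
      rw [rng_snoc]
      by_cases hS : S ⊆ insert e (rng ω)
      · by_cases he : e ∈ S
        · have : S.erase e ⊆ rng ω := by
            intro x hx
            have := hS (mem_of_mem_erase hx)
            rcases mem_insert.1 this with h | h
            · exact absurd h (ne_of_mem_erase hx)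
            · exact h
          simp only [hS, he, this, if_true, and_self]
          split_ifs <;> norm_num
        · have : S ⊆ rng ω := by
            intro x hx
            rcases mem_insert.1 (hS hx) with h | h
            · exact absurd (h ▸ hx) he
            · exact h
          simp only [hS, this, if_true]
          split_ifs <;> norm_num
      · simp only [hS, if_false]
        split_ifs <;> norm_num
    rw [Pr_def, Ex_succ]
    refine (Ex_mono key).trans ?_
    rw [Ex_add, Ex_div, Ex_sum]
    simp_rw [← Pr_def]
    have h1 := ih S
    have h2 : ∑ e ∈ S, Pr m (fun ω => S.erase e ⊆ rng ω) ≤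
        S.card * ((m : ℝ) / Fintype.card α) ^ (S.card - 1) := by
      rw [← nsmul_eq_mul]
      refine sum_le_card_nsmul _ _ _ fun e he => ?_
      rw [← card_erase_of_mem he]
      exact ih _
    have h3 := pow_add_lower ((m : ℝ) / Fintype.card α) (1 / Fintype.card α) (by positivity)
      (by positivity) S.card
    have h4 : ((m + 1 : ℕ) : ℝ) / Fintype.card α = (m : ℝ) / Fintype.card α + 1 / Fintype.card α := by
      push_cast; ring
    rw [h4]
    refine le_trans ?_ h3
    refine add_le_add h1 ?_
    rw [div_le_iff₀ hN]
    refine h2.trans (le_of_eq ?_)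
    field_simp

lemma Pr_notMem [Nonempty α] (a : α) (m : ℕ) :
    Pr m (fun ω => a ∉ rng ω) ≤ (1 - 1 / (Fintype.card α : ℝ)) ^ m := by
  have hN : (0 : ℝ) < Fintype.card α := by exact_mod_cast Fintype.card_pos
  induction m with
  | zero => simpa using Pr_le_one _
  | succ m ih =>
    rw [Pr_def, Ex_succ]
    have key : ∀ ω : Fin m → α, (∑ e, if a ∉ rng (Fin.snoc ω e : Fin (m + 1) → α) then (1 : ℝ) else 0)
        / (Fintype.card α : ℝ) ≤ (1 - 1 / (Fintype.card α : ℝ)) *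
          (if a ∉ rng ω then (1 : ℝ) else 0) := by
      intro ω
      by_cases h : a ∈ rng ω
      · simp [rng_snoc, h]
      · rw [div_le_iff₀ hN]
        simp only [rng_snoc, mem_insert, h, or_false, not_false_eq_true, if_true, mul_one]
        rw [← sum_filter, sum_const, nsmul_eq_mul, mul_one]
        have : (univ.filter fun e => ¬ a = e) = univ.erase a := by ext; simp [eq_comm]
        rw [this, card_erase_of_mem (mem_univ _), card_univ, Nat.cast_sub Fintype.card_pos]
        field_simp
        simp
    refine (Ex_mono key).trans ?_
    rw [Ex_mul, pow_succ', ← Pr_def]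
    refine mul_le_mul_of_nonneg_left ih ?_
    have : (1 : ℝ) ≤ Fintype.card α := by exact_mod_cast Fintype.card_pos
    rw [sub_nonneg, div_le_one hN]
    exact this

lemma Pr_subset_ge [Nonempty α] (k : ℕ) (q : ℝ) (hq : 0 ≤ q)
    (hq' : q ≤ 1 - (1 - 1 / (Fintype.card α : ℝ)) ^ k) (S : Finset α) :
    q ^ S.card ≤ Pr (S.card * k) (fun ω => S ⊆ rng ω) := by
  induction S using Finset.induction_on with
  | empty =>
    simp [Pr, Ex_const]
  | insert a S ha ih =>
    rw [card_insert_of_notMem ha, Nat.succ_mul, pow_succ]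
    have h1 : q ≤ Pr k (fun ω => a ∈ rng ω) := by
      have := Pr_compl (m := k) (fun ω : Fin k → α => a ∈ rng ω)
      have := Pr_notMem a k
      linarith
    refine (mul_le_mul ih h1 hq (Pr_nonneg _)).trans ?_
    apply Pr_append_ge
    intro ω ω' h1 h2
    rw [rng_append]
    intro x hx
    rcases mem_insert.1 hx with rfl | hx
    · exact mem_union_right _ h2
    · exact mem_union_left _ (h1 hx)

variable {Φ : Type*} [Fintype Φ] (E : Φ → Finset α)

/-- `e` lies in a copy inside `U`. -/
def clo (U : Finset α) (e : α) : Prop := ∃ φ, e ∈ E φ ∧ E φ ⊆ U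

lemma clo_mono {U V : Finset α} (h : U ⊆ V) {e : α} (he : clo E U e) : clo E V e := by
  obtain ⟨φ, h1, h2⟩ := he
  exact ⟨φ, h1, h2.trans h⟩

/-- Survivors of the process driven by the sequence `ω`. -/
noncomputable def surv {m : ℕ} (ω : Fin m → α) : Finset α :=
  univ.filter fun e => ∃ i, ω i = e ∧ (∀ j < i, ω j ≠ e) ∧
    ¬ clo E ((univ.filter (· ≤ i)).image ω) e

/-- Number of survivors. -/
noncomputable def cnt {m : ℕ} (ω : Fin m → α) : ℕ := (surv E ω).card

lemma surv_subset {m : ℕ} (ω : Fin m → α) : surv E ω ⊆ rng ω := by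
  intro e he
  simp only [surv, mem_filter, mem_univ, true_and] at he
  obtain ⟨i, hi, _⟩ := he
  simp only [rng, mem_image, mem_univ, true_and]
  exact ⟨i, hi⟩

lemma surv_snoc {m : ℕ} (ω : Fin m → α) (e : α) :
    surv E (Fin.snoc ω e : Fin (m + 1) → α) =
      if e ∉ rng ω ∧ ¬ clo E (insert e (rng ω)) e then insert e (surv E ω) else surv E ω := by
  have him : ∀ i : Fin m, (univ.filter (· ≤ i.castSucc)).image (Fin.snoc ω e : Fin (m + 1) → α) =
      (univ.filter (· ≤ i)).image ω := by
    intro i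
    ext x
    simp only [mem_image, mem_filter, mem_univ, true_and]
    constructor
    · rintro ⟨j, hj, rfl⟩
      revert hj
      refine Fin.lastCases ?_ (fun j => ?_) j
      · intro hj
        exact absurd hj (not_le.2 (Fin.castSucc_lt_last i))
      · intro hj
        exact ⟨j, by simpa using hj, by simp⟩
    · rintro ⟨j, hj, rfl⟩
      exact ⟨j.castSucc, by simpa using hj, by simp⟩
  have hlast : (univ.filter (· ≤ Fin.last m)).image (Fin.snoc ω e : Fin (m + 1) → α) =
      insert e (rng ω) := by
    rw [← rng_snoc]
    unfold rng
    congr 1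
    ext i
    simp [Fin.le_last]
  have hmem : ∀ x, x ∈ surv E (Fin.snoc ω e : Fin (m + 1) → α) ↔
      x ∈ surv E ω ∨ (x = e ∧ e ∉ rng ω ∧ ¬ clo E (insert e (rng ω)) e) := by
    intro x
    simp only [surv, mem_filter, mem_univ, true_and]
    constructor
    · rintro ⟨i, hi⟩
      revert hi
      refine Fin.lastCases ?_ (fun i => ?_) i
      · rintro ⟨h1, h2, h3⟩
        right
        rw [hlast] at h3
        have hxe : x = e := by simpa using h1.symm
        subst hxe
        refine ⟨rfl, ?_, h3⟩
        simp only [rng, mem_image, mem_univ, true_and, not_exists]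
        intro j
        have := h2 j.castSucc (Fin.castSucc_lt_last j)
        simpa using this
      · rintro ⟨h1, h2, h3⟩
        left
        rw [him] at h3
        refine ⟨i, by simpa using h1, fun j hj => ?_, h3⟩
        have := h2 j.castSucc (by simpa using hj)
        simpa using this
    · rintro (⟨i, h1, h2, h3⟩ | ⟨rfl, h2, h3⟩)
      · refine ⟨i.castSucc, by simpa using h1, ?_, by rwa [him]⟩
        intro j
        refine Fin.lastCases ?_ (fun j => ?_) j
        · intro hj
          exact absurd hj (not_lt.2 (Fin.castSucc_lt_last i).le)
        · intro hj
          simpa using h2 j (by simpa using hj)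
      · refine ⟨Fin.last m, by simp, ?_, by rwa [hlast]⟩
        intro j
        refine Fin.lastCases ?_ (fun j => ?_) j
        · intro hj; exact absurd hj (lt_irrefl _)
        · intro _
          simp only [rng, mem_image, mem_univ, true_and, not_exists] at h2
          simpa using h2 j
  ext x
  rw [hmem]
  split_ifs with h
  · rw [mem_insert]; tauto
  · tauto

lemma cnt_snoc {m : ℕ} (ω : Fin m → α) (e : α) :
    cnt E (Fin.snoc ω e : Fin (m + 1) → α) =
      cnt E ω + if e ∉ rng ω ∧ ¬ clo E (insert e (rng ω)) e then 1 else 0 := by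
  unfold cnt
  rw [surv_snoc]
  split_ifs with h
  · rw [card_insert_of_notMem fun h' => h.1 (surv_subset E ω h')]
  · rfl

lemma cnt_le_card {m : ℕ} (ω : Fin m → α) : cnt E ω ≤ Fintype.card α := by
  unfold cnt
  exact card_le_univ _

lemma cnt_append_ge {m k : ℕ} (ω : Fin m → α) (ω' : Fin k → α) :
    cnt E ω ≤ cnt E (Fin.append ω ω') := by
  unfold cnt
  apply card_le_card
  intro e he
  simp only [surv, mem_filter, mem_univ, true_and] at he ⊢
  obtain ⟨i, h1, h2, h3⟩ := he
  refine ⟨Fin.castAdd k i, by simpa using h1, ?_, ?_⟩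
  · intro j
    refine Fin.addCases (fun j => ?_) (fun j => ?_) j
    · intro hj
      simpa using h2 j (Fin.lt_def.2 (Fin.lt_def.1 hj))
    · intro hj
      exfalso
      rw [Fin.lt_def] at hj
      simp at hj
      omega
  · intro h
    apply h3
    refine clo_mono E ?_ h
    intro x
    simp only [mem_image, mem_filter, mem_univ, true_and]
    rintro ⟨j, hj, rfl⟩
    revert hj
    refine Fin.addCases (fun j => ?_) (fun j => ?_) j
    · intro hj
      exact ⟨j, Fin.le_def.2 (Fin.le_def.1 hj), by simp⟩
    · intro hj
      exfalso
      rw [Fin.le_def] at hj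
      simp at hj
      omega

end Hyper

section Hyper2
set_option linter.unusedSectionVars false
open Finset
open scoped Classical

variable {α : Type*} [Fintype α] {Φ : Type*} [Fintype Φ] (E : Φ → Finset α)

/-- Expected number of survivors after `m` steps. -/
noncomputable def ec (m : ℕ) : ℝ := Ex m (fun ω : Fin m → α => (cnt E ω : ℝ))

lemma ec_succ [Nonempty α] (m : ℕ) : ec E (m + 1) = ec E m +
    (∑ e, Pr m (fun ω => e ∉ rng ω ∧ ¬ clo E (insert e (rng ω)) e)) / (Fintype.card α : ℝ) := by
  have hN : (0 : ℝ) < Fintype.card α := by exact_mod_cast Fintype.card_pos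
  unfold ec Pr
  rw [Ex_succ, ← Ex_sum, ← Ex_div, ← Ex_add]
  congr 1
  ext ω
  simp_rw [cnt_snoc]
  push_cast
  rw [sum_add_distrib, add_div]
  congr 1
  · simp only [sum_const, card_univ, nsmul_eq_mul]
    field_simp
  · congr 1
    refine sum_congr rfl fun e _ => ?_
    congr

lemma Pr_notclosed_pow [Nonempty α] (g : α) (m1 : ℕ) (r : ℝ)
    (h : Pr m1 (fun ω => ¬ clo E (insert g (rng ω)) g) ≤ r) (k j : ℕ) :
    Pr (k * m1 + j) (fun ω => ¬ clo E (insert g (rng ω)) g) ≤ r ^ k := by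
  have hr : 0 ≤ r := (Pr_nonneg _).trans h
  have h0 : Pr (k * m1) (fun ω => ¬ clo E (insert g (rng ω)) g) ≤ r ^ k := by
    induction k with
    | zero => simpa using Pr_le_one _
    | succ k ih =>
      rw [Nat.succ_mul, pow_succ]
      refine (Pr_append_le _ (fun ω => ¬ clo E (insert g (rng ω)) g)
        (fun ω => ¬ clo E (insert g (rng ω)) g) ?_).trans
        (mul_le_mul ih h (Pr_nonneg _) (by positivity))
      intro ω ω' hn
      rw [rng_append] at hn
      constructor
      · intro hc
        exact hn (clo_mono E (insert_subset_insert _ subset_union_left) hc)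
      · intro hc
        exact hn (clo_mono E (insert_subset_insert _ subset_union_right) hc)
  refine (Pr_append_le _ (fun ω => ¬ clo E (insert g (rng ω)) g) (fun _ => True) ?_).trans ?_
  · intro ω ω' hn
    rw [rng_append] at hn
    refine ⟨fun hc => ?_, trivial⟩
    exact hn (clo_mono E (insert_subset_insert _ subset_union_left) hc)
  · have : Pr j (fun _ : Fin j → α => True) ≤ 1 := Pr_le_one _
    nlinarith [Pr_nonneg (fun _ : Fin j → α => True),
      Pr_nonneg (fun ω : Fin (k * m1) → α => ¬ clo E (insert g (rng ω)) g)]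

lemma ec_block [Nonempty α] (m1 : ℕ) (r : ℝ)
    (h : ∀ g, Pr m1 (fun ω => ¬ clo E (insert g (rng ω)) g) ≤ r) (k j : ℕ) :
    ec E (k * m1 + j) ≤ ec E (k * m1) + j * r ^ k := by
  have hN : (0 : ℝ) < Fintype.card α := by exact_mod_cast Fintype.card_pos
  induction j with
  | zero => simp
  | succ j ih =>
    rw [← add_assoc, ec_succ]
    have : (∑ e, Pr (k * m1 + j) (fun ω => e ∉ rng ω ∧ ¬ clo E (insert e (rng ω)) e)) /
        (Fintype.card α : ℝ) ≤ r ^ k := by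
      rw [div_le_iff₀ hN]
      refine (sum_le_card_nsmul _ _ (r ^ k) fun e _ => ?_).trans ?_
      · exact (Pr_mono fun ω h => h.2).trans (Pr_notclosed_pow E e m1 r (h e) k j)
      · simp [mul_comm]
    push_cast
    linarith

lemma ec_tail [Nonempty α] (m1 : ℕ) (r : ℝ) (hr : r < 1)
    (h : ∀ g, Pr m1 (fun ω => ¬ clo E (insert g (rng ω)) g) ≤ r) (j k : ℕ) :
    ec E ((k + j) * m1) ≤ ec E (k * m1) + m1 * r ^ k / (1 - r) := by
  have hr0 : 0 ≤ r := (Pr_nonneg _).trans (h (Classical.arbitrary α))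
  induction j generalizing k with
  | zero =>
    have : 0 ≤ m1 * r ^ k / (1 - r) := div_nonneg (by positivity) (by linarith)
    simpa using this
  | succ j ih =>
    have h1 := ih (k + 1)
    have h2 := ec_block E m1 r h k m1
    rw [show k * m1 + m1 = (k + 1) * m1 by ring] at h2
    rw [show k + (j + 1) = k + 1 + j by ring]
    have h3 : m1 * r ^ k / (1 - r) = m1 * r ^ k + m1 * r ^ (k + 1) / (1 - r) := by
      have : 1 - r ≠ 0 := by linarith
      field_simp
      ring
    linarith

lemma ec_zero : ec E 0 = 0 := by
  unfold ec
  have : ∀ ω : Fin 0 → α, cnt E ω = 0 := by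
    intro ω
    unfold cnt
    rw [card_eq_zero, ← subset_empty]
    refine (surv_subset E ω).trans ?_
    simp [rng]
  simp [this, Ex]

lemma ec_mono [Nonempty α] (m k : ℕ) : ec E m ≤ ec E (m + k) := by
  unfold ec
  rw [Ex_append]
  refine Ex_mono fun ω => ?_
  rw [← Ex_const (α := α) (m := k) (cnt E ω : ℝ)]
  refine Ex_mono fun ω' => ?_
  exact_mod_cast cnt_append_ge E ω ω'

/-- Lower bound on the expected number of survivors. -/
lemma ec_lower [Nonempty α] (m : ℕ) (η : ℝ)
    (h : ∀ i < m, ∀ g : α, (i : ℝ) / Fintype.card α +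
      ∑ φ with g ∈ E φ, ((i : ℝ) / Fintype.card α) ^ ((E φ).erase g).card ≤ η) :
    m * (1 - η) ≤ ec E m := by
  have hN : (0 : ℝ) < Fintype.card α := by exact_mod_cast Fintype.card_pos
  induction m with
  | zero => simp [ec_zero]
  | succ m ih =>
    have h1 := ih fun i hi => h i (by omega)
    rw [ec_succ]
    have : 1 - η ≤ (∑ e, Pr m (fun ω => e ∉ rng ω ∧ ¬ clo E (insert e (rng ω)) e)) /
        (Fintype.card α : ℝ) := by
      rw [le_div_iff₀ hN]
      have hh : ∀ e ∈ (univ : Finset α), 1 - η ≤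
          Pr m (fun ω => e ∉ rng ω ∧ ¬ clo E (insert e (rng ω)) e) := by
        intro g _
        have h2 : Pr m (fun ω => ¬ (g ∉ rng ω ∧ ¬ clo E (insert g (rng ω)) g)) ≤ η := by
          refine le_trans ?_ (h m (by omega) g)
          have h3 : Pr m (fun ω => ¬ (g ∉ rng ω ∧ ¬ clo E (insert g (rng ω)) g)) ≤
              Pr m (fun ω => {g} ⊆ rng ω ∨
                ∃ φ : {φ // g ∈ E φ}, (E φ.1).erase g ⊆ rng ω) := by
            refine Pr_mono fun ω hω => ?_
            rw [not_and_or, not_not, not_not] at hω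
            rcases hω with hω | ⟨φ, h1, h2⟩
            · left; simpa using hω
            · right
              refine ⟨⟨φ, h1⟩, fun x hx => ?_⟩
              rcases mem_insert.1 (h2 (mem_of_mem_erase hx)) with h | h
              · exact absurd h (ne_of_mem_erase hx)
              · exact h
          refine h3.trans ((Pr_or _ _).trans (add_le_add ?_ ?_))
          · simpa using Pr_subset_le m ({g} : Finset α)
          · refine (Pr_exists _).trans ?_
            rw [← sum_subtype_eq_sum_filter]
            rw [show (Finset.subtype (fun φ => g ∈ E φ) univ) = univ by ext; simp]
            exact sum_le_sum fun φ _ => Pr_subset_le m _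
        have := Pr_compl (m := m) (fun ω : Fin m → α => g ∉ rng ω ∧ ¬ clo E (insert g (rng ω)) g)
        linarith
      have := card_nsmul_le_sum univ _ _ hh
      simpa [mul_comm] using this
    push_cast
    linarith

/-- Number of copies through `g` present in the sequence (possibly up to `g` itself). -/
noncomputable def xg (g : α) {m : ℕ} (ω : Fin m → α) : ℕ :=
  (univ.filter fun φ => g ∈ E φ ∧ E φ ⊆ insert g (rng ω)).card

lemma moment_aux [Nonempty α] (g : α) (m : ℕ) (p : ℝ) (hp : (m : ℝ) / Fintype.card α ≤ p)
    (sz : Finset α → ℕ) (v : ℕ) (hsz : ∀ U φ, sz (U ∪ E φ) ≤ sz U + v)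
    (b : ℕ → ℝ) (hb : Monotone b) (hb0 : ∀ s, 0 ≤ b s)
    (hext : ∀ U : Finset α, ∑ φ with ¬ Disjoint (E φ) U, p ^ (E φ \ U).card ≤ b (sz U))
    (M : ℕ) (k : ℕ) : ∀ U : Finset α, g ∈ U → sz U + k * v ≤ M →
    Ex m (fun ω => (xg E g ω : ℝ) ^ k * (if U ⊆ insert g (rng ω) then (1 : ℝ) else 0)) ≤
      p ^ (U.erase g).card * b M ^ k := by
  have hp0 : 0 ≤ p := le_trans (by positivity) hp
  induction k with
  | zero =>
    intro U hg _
    simp only [pow_zero, one_mul, mul_one]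
    have h1 : Ex m (fun ω => (if U ⊆ insert g (rng ω) then (1 : ℝ) else 0)) ≤
        Pr m (fun ω => U.erase g ⊆ rng ω) := by
      rw [← Pr_def]
      refine Pr_mono fun ω h x hx => ?_
      rcases mem_insert.1 (h (mem_of_mem_erase hx)) with h | h
      · exact absurd h (ne_of_mem_erase hx)
      · exact h
    refine h1.trans ((Pr_subset_le m _).trans ?_)
    gcongr
  | succ k ih =>
    intro U hg hM
    have key : ∀ ω : Fin m → α, (xg E g ω : ℝ) ^ (k + 1) *
        (if U ⊆ insert g (rng ω) then (1 : ℝ) else 0) =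
        ∑ φ with g ∈ E φ, (xg E g ω : ℝ) ^ k *
          (if U ∪ E φ ⊆ insert g (rng ω) then (1 : ℝ) else 0) := by
      intro ω
      rw [← mul_sum, pow_succ, mul_assoc]
      congr 1
      have h1 : (xg E g ω : ℝ) = ∑ φ with g ∈ E φ,
          (if E φ ⊆ insert g (rng ω) then (1 : ℝ) else 0) := by
        unfold xg
        rw [← sum_filter, filter_filter]
        simp
      rw [h1, sum_mul]
      refine sum_congr rfl fun φ _ => ?_
      by_cases h2 : E φ ⊆ insert g (rng ω) <;> by_cases h3 : U ⊆ insert g (rng ω) <;>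
        simp [h2, h3, union_subset_iff]
    simp_rw [key]
    rw [Ex_sum]
    calc ∑ φ with g ∈ E φ, Ex m (fun ω => (xg E g ω : ℝ) ^ k *
          (if U ∪ E φ ⊆ insert g (rng ω) then (1 : ℝ) else 0))
        ≤ ∑ φ with g ∈ E φ, (p ^ (U.erase g).card * b M ^ k) * p ^ (E φ \ U).card := by
          refine sum_le_sum fun φ hφ => ?_
          have hφ' : g ∈ E φ := by simpa using hφ
          refine (ih (U ∪ E φ) (mem_union_left _ hg) ?_).trans (le_of_eq ?_)
          · have := hsz U φ
            rw [Nat.succ_mul] at hM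
            omega
          · have : ((U ∪ E φ).erase g).card = (U.erase g).card + (E φ \ U).card := by
              rw [card_erase_of_mem (mem_union_left _ hg), card_erase_of_mem hg,
                ← union_sdiff_self_eq_union, card_union_of_disjoint disjoint_sdiff]
              have := card_pos.2 ⟨g, hg⟩
              omega
            rw [this, pow_add]
            ring
      _ = (p ^ (U.erase g).card * b M ^ k) * ∑ φ with g ∈ E φ, p ^ (E φ \ U).card := by
          rw [mul_sum]
      _ ≤ (p ^ (U.erase g).card * b M ^ k) * b M := by
          have := hb0 M
          gcongr
          refine le_trans ?_ ((hext U).trans (hb (by omega)))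
          refine sum_le_sum_of_subset_of_nonneg ?_ fun _ _ _ => by positivity
          intro φ hφ
          simp only [mem_filter, mem_univ, true_and] at hφ ⊢
          exact not_disjoint_iff.2 ⟨g, hφ, hg⟩
      _ = _ := by ring

lemma moment_tail [Nonempty α] (g : α) (m : ℕ) (p : ℝ) (hp : (m : ℝ) / Fintype.card α ≤ p)
    (sz : Finset α → ℕ) (v : ℕ) (hsz : ∀ U φ, sz (U ∪ E φ) ≤ sz U + v)
    (b : ℕ → ℝ) (hb : Monotone b) (hb0 : ∀ s, 0 ≤ b s)
    (hext : ∀ U : Finset α, ∑ φ with ¬ Disjoint (E φ) U, p ^ (E φ \ U).card ≤ b (sz U))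
    (k : ℕ) (s : ℕ) (hs : sz {g} ≤ s) (lam : ℝ) (hlam : 0 < lam) :
    Pr m (fun ω => lam ≤ (xg E g ω : ℝ)) ≤ (b (s + k * v) / lam) ^ k := by
  have h1 := moment_aux E g m p hp sz v hsz b hb hb0 hext (s + k * v) k {g}
    (by simp) (by omega)
  have h2 := markov (fun ω : Fin m → α => (xg E g ω : ℝ) ^ k) (fun ω => by positivity)
    (lam ^ k) (by positivity)
  have h3 : Pr m (fun ω => lam ≤ (xg E g ω : ℝ)) ≤
      Pr m (fun ω => lam ^ k ≤ (xg E g ω : ℝ) ^ k) := by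
    refine Pr_mono fun ω h => ?_
    gcongr
  refine h3.trans (h2.trans ?_)
  rw [div_pow]
  gcongr
  have h4 : ({g} : Finset α).erase g = ∅ := by ext; simp
  simpa [h4] using h1

/-- Second moment bound: `g` gets closed with positive probability. -/
lemma closed_lower [Nonempty α] (g : α) (Φ₀ : Finset Φ) (hΦ : ∀ φ ∈ Φ₀, g ∈ E φ)
    (e : ℕ) (he : ∀ φ, (E φ).card = e + 1) (k : ℕ) (q p D : ℝ) (hq : 0 < q)
    (hq' : q ≤ 1 - (1 - 1 / (Fintype.card α : ℝ)) ^ k)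
    (hp : ((e * k : ℕ) : ℝ) / Fintype.card α ≤ p)
    (hD : ∀ φ ∈ Φ₀, ∑ φ' ∈ Φ₀, p ^ (E φ' \ E φ).card ≤ D) (hD0 : 0 < D) (hp0 : 0 < p)
    (hne : Φ₀.Nonempty) :
    (Φ₀.card : ℝ) * q ^ (2 * e) / (p ^ e * D) ≤
      Pr (e * k) (fun ω => clo E (insert g (rng ω)) g) := by
  set F : (Fin (e * k) → α) → ℝ :=
    fun ω => ∑ φ ∈ Φ₀, if (E φ).erase g ⊆ rng ω then (1 : ℝ) else 0 with hF
  have hF0 : ∀ ω, 0 ≤ F ω := fun ω => sum_nonneg fun φ _ => by split_ifs <;> norm_num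
  have hcard : ∀ φ ∈ Φ₀, ((E φ).erase g).card = e := by
    intro φ hφ
    rw [card_erase_of_mem (hΦ φ hφ), he]; rfl
  have h1 : (Φ₀.card : ℝ) * q ^ e ≤ Ex (e * k) F := by
    rw [hF, Ex_sum, ← nsmul_eq_mul]
    refine card_nsmul_le_sum _ _ _ fun φ hφ => ?_
    rw [← Pr_def]
    have := Pr_subset_ge k q hq.le hq' ((E φ).erase g)
    rwa [hcard φ hφ] at this
  have h2 : Ex (e * k) (fun ω => F ω ^ 2) ≤ Φ₀.card * (p ^ e * D) := by
    have : ∀ ω, F ω ^ 2 = ∑ φ ∈ Φ₀, ∑ φ' ∈ Φ₀,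
        if (E φ ∪ E φ').erase g ⊆ rng ω then (1 : ℝ) else 0 := by
      intro ω
      rw [sq, hF, sum_mul_sum]
      refine sum_congr rfl fun φ _ => sum_congr rfl fun φ' _ => ?_
      rw [erase_union_distrib]
      by_cases h2 : (E φ).erase g ⊆ rng ω <;> by_cases h3 : (E φ').erase g ⊆ rng ω <;>
        simp [h2, h3, union_subset_iff]
    simp_rw [this]
    rw [Ex_sum, ← nsmul_eq_mul]
    refine sum_le_card_nsmul _ _ _ fun φ hφ => ?_
    rw [Ex_sum]
    calc _ ≤ ∑ φ' ∈ Φ₀, p ^ e * p ^ (E φ' \ E φ).card := by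
          refine sum_le_sum fun φ' hφ' => ?_
          rw [← Pr_def]
          refine (Pr_subset_le _ _).trans ?_
          have : ((E φ ∪ E φ').erase g).card = e + (E φ' \ E φ).card := by
            rw [card_erase_of_mem (mem_union_left _ (hΦ φ hφ)),
              ← union_sdiff_self_eq_union, card_union_of_disjoint disjoint_sdiff, he]
            omega
          rw [this, ← pow_add]
          gcongr
      _ ≤ p ^ e * D := by
          rw [← mul_sum]
          gcongr
          exact hD φ hφ
  have h3 := second_moment F hF0
  have h4 : Pr (e * k) (fun ω => 0 < F ω) ≤ Pr (e * k) (fun ω => clo E (insert g (rng ω)) g) := by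
    refine Pr_mono fun ω hω => ?_
    obtain ⟨φ, hφ, hne⟩ := exists_ne_zero_of_sum_ne_zero hω.ne'
    have h5 : (E φ).erase g ⊆ rng ω := by
      by_contra hcon
      simp [hcon] at hne
    exact ⟨φ, hΦ φ hφ, by rw [← insert_erase (hΦ φ hφ)]; exact insert_subset_insert _ h5⟩
  have hc : (0 : ℝ) < Φ₀.card := by exact_mod_cast card_pos.2 hne
  have h5 : ((Φ₀.card : ℝ) * q ^ e) ^ 2 ≤ Φ₀.card * (p ^ e * D) *
      Pr (e * k) (fun ω => clo E (insert g (rng ω)) g) := by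
    refine (pow_le_pow_left₀ (by positivity) h1 2).trans (h3.trans ?_)
    refine mul_le_mul h2 h4 (Pr_nonneg _) (by positivity)
  rw [div_le_iff₀ (by positivity)]
  have h6 : (Φ₀.card : ℝ) * ((Φ₀.card : ℝ) * q ^ (2 * e)) ≤ Φ₀.card *
     (Pr (e * k) (fun ω => clo E (insert g (rng ω)) g) * (p ^ e * D)) := by
    calc _ = ((Φ₀.card : ℝ) * q ^ e) ^ 2 := by rw [pow_mul']; ring
      _ ≤ _ := h5
      _ = _ := by ring
  exact le_of_mul_le_mul_left h6 hc

lemma cnt_lip {m : ℕ} (x y : Fin m → α) (e : ℕ) (he : ∀ φ, (E φ).card ≤ e) (lam : ℝ)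
    (hy : ∀ g, (xg E g y : ℝ) ≤ lam) :
    (cnt E x : ℝ) ≤ cnt E y + (2 + e * lam) * hammingDist x y := by
  set S : Finset (Fin m) := univ.filter fun i => x i ≠ y i with hS
  have hSc : S.card = hammingDist x y := rfl
  set T : α → Finset α := fun g =>
    (univ.filter fun φ => g ∈ E φ ∧ E φ ⊆ insert g (rng y)).biUnion E with hT
  have hsub : surv E x ⊆ surv E y ∪ (S.image x ∪ S.image y ∪ (S.biUnion fun j => T (y j))) := by
    intro a ha
    by_cases hay : a ∈ surv E y
    · exact mem_union_left _ hay
    refine mem_union_right _ ?_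
    simp only [surv, mem_filter, mem_univ, true_and] at ha hay
    obtain ⟨i, h1, h2, h3⟩ := ha
    by_cases hi : i ∈ S
    · exact mem_union_left _ (mem_union_left _ (mem_image.2 ⟨i, hi, h1⟩))
    have hyi : y i = a := by
      rw [← h1]
      by_contra hne
      exact hi (by simp [hS]; exact fun h => hne h.symm)
    by_cases hnew : ∀ j < i, y j ≠ a
    · have hcl : clo E ((univ.filter (· ≤ i)).image y) a := by
        by_contra hcon
        exact hay ⟨i, hyi, hnew, hcon⟩
      obtain ⟨φ, haφ, hφ⟩ := hcl
      have : ¬ E φ ⊆ (univ.filter (· ≤ i)).image x := fun h => h3 ⟨φ, haφ, h⟩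
      obtain ⟨g, hg, hgx⟩ := not_subset.1 this
      obtain ⟨j, hj, hjg⟩ := mem_image.1 (hφ hg)
      have hjS : j ∈ S := by
        simp only [hS, mem_filter, mem_univ, true_and]
        intro heq
        exact hgx (mem_image.2 ⟨j, hj, by rw [heq, hjg]⟩)
      refine mem_union_right _ (mem_biUnion.2 ⟨j, hjS, ?_⟩)
      simp only [hT, mem_biUnion, mem_filter, mem_univ, true_and]
      refine ⟨φ, ⟨by rw [hjg]; exact hg, ?_⟩, haφ⟩
      refine hφ.trans (subset_trans ?_ (subset_insert _ _))
      exact image_subset_image (subset_univ _)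
    · push Not at hnew
      obtain ⟨j, hj, hja⟩ := hnew
      have hjS : j ∈ S := by
        simp only [hS, mem_filter, mem_univ, true_and]
        intro heq
        exact h2 j hj (by rw [heq, hja])
      exact mem_union_left _ (mem_union_right _ (mem_image.2 ⟨j, hjS, hja⟩))
  have hTc : ∀ g, ((T g).card : ℝ) ≤ e * lam := by
    intro g
    have h1 : (T g).card ≤ xg E g y * e := by
      simp only [hT]
      exact card_biUnion_le_card_mul _ _ _ fun φ _ => he φ
    calc ((T g).card : ℝ) ≤ xg E g y * e := by exact_mod_cast h1
      _ ≤ lam * e := by gcongr; exact hy g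
      _ = _ := by ring
  have h1 : ((surv E x).card : ℝ) ≤ (surv E y).card + (S.card + S.card + S.card * (e * lam)) := by
    have h2 := (card_le_card hsub).trans (card_union_le _ _)
    have h3 := card_union_le (S.image x ∪ S.image y) (S.biUnion fun j => T (y j))
    have h4 := card_union_le (S.image x) (S.image y)
    have h5 : (S.image x).card ≤ S.card := card_image_le
    have h6 : (S.image y).card ≤ S.card := card_image_le
    have h7 : ((S.biUnion fun j => T (y j)).card : ℝ) ≤ S.card * (e * lam) := by
      have : (S.biUnion fun j => T (y j)).card ≤ ∑ j ∈ S, (T (y j)).card := card_biUnion_le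
      calc ((S.biUnion fun j => T (y j)).card : ℝ) ≤ ∑ j ∈ S, ((T (y j)).card : ℝ) := by
            exact_mod_cast this
        _ ≤ S.card • (e * lam) := sum_le_card_nsmul _ _ _ fun j _ => hTc _
        _ = _ := by simp
    have h8 : (surv E x).card ≤ (surv E y).card +
        (S.card + S.card + (S.biUnion fun j => T (y j)).card) := by omega
    have h9 : ((surv E x).card : ℝ) ≤ (surv E y).card +
        (S.card + S.card + (S.biUnion fun j => T (y j)).card) := by exact_mod_cast h8
    linarith
  unfold cnt
  rw [← hSc]
  linarith

end Hyper2

section Link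
set_option linter.unusedSectionVars false
open Finset
open scoped Classical

section abs
variable {α : Type*} [Fintype α] {Φ : Type*} [Fintype Φ] (E : Φ → Finset α)

/-- Uniform deletion process. -/
noncomputable def Dv (h : ℕ → ℝ) : ℕ → Finset α → ℕ → ℝ
  | 0, _, j => h j
  | k + 1, U, j => (∑ e ∈ U, Dv h k (U.erase e) (j + if clo E U e then 0 else 1)) / ((k : ℝ) + 1)

/-- Number of surjections. -/
noncomputable def surjNum : ℕ → ℕ → ℝ
  | 0, 0 => 1
  | 0, _ + 1 => 0
  | m + 1, k => k * (surjNum m k + surjNum m (k - 1))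

lemma sum_surj (h : ℕ → ℝ) (m : ℕ) : ∀ (U : Finset α) (j : ℕ),
    (∑ ω : Fin m → α, if rng ω = U then h (j + cnt E ω) else 0) =
      surjNum m U.card * Dv E h U.card U j := by
  induction m with
  | zero =>
    intro U j
    have hr : ∀ ω : Fin 0 → α, rng ω = ∅ := by intro ω; simp [rng]
    have hc : ∀ ω : Fin 0 → α, cnt E ω = 0 := by
      intro ω
      unfold cnt
      rw [card_eq_zero, ← subset_empty]
      exact (surv_subset E ω).trans (hr ω).subset
    simp_rw [hr, hc]
    rcases U.eq_empty_or_nonempty with rfl | hU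
    · simp [surjNum, Dv]
    · obtain ⟨k, hk⟩ : ∃ k, U.card = k + 1 := ⟨U.card - 1, by have := card_pos.2 hU; omega⟩
      rw [hk]
      have : ¬ (∅ = U) := fun h => hU.ne_empty h.symm
      simp [surjNum, this]
  | succ m ih =>
    intro U j
    rw [sum_snoc, sum_comm]
    have key : ∀ e, (∑ ω : Fin m → α, if rng (Fin.snoc ω e : Fin (m + 1) → α) = U then
        h (j + cnt E (Fin.snoc ω e : Fin (m + 1) → α)) else 0) =
        if e ∈ U then (surjNum m U.card * Dv E h U.card U j +
          surjNum m (U.card - 1) * Dv E h (U.card - 1) (U.erase e)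
            (j + if clo E U e then 0 else 1)) else 0 := by
      intro e
      by_cases he : e ∈ U
      · rw [if_pos he, ← ih, ← card_erase_of_mem he, ← ih, ← sum_add_distrib]
        refine sum_congr rfl fun ω _ => ?_
        rw [rng_snoc, cnt_snoc]
        by_cases her : e ∈ rng ω
        · have h1 : rng ω ≠ U.erase e := by
            intro h1; rw [h1] at her; simp at her
          simp [h1, her]
        · have h1 : rng ω ≠ U := by
            intro h1; rw [h1] at her; exact her he
          have h2 : insert e (rng ω) = U ↔ rng ω = U.erase e := by
            constructor
            · intro h; rw [← h, erase_insert her]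
            · intro h; rw [h, insert_erase he]
          simp only [h1, if_false, zero_add, h2]
          by_cases h3 : rng ω = U.erase e
          · rw [if_pos h3, if_pos h3, h2.2 h3]
            by_cases h4 : clo E U e
            · simp [h4]
            · simp only [h4, her, not_false_eq_true, and_self, if_true, if_false]
              congr 1
              omega
          · rw [if_neg h3, if_neg h3]
      · rw [if_neg he]
        apply Finset.sum_eq_zero
        intro ω _
        rw [rng_snoc, if_neg]
        intro h; rw [← h] at he; simp at he
    simp_rw [key]
    rw [← sum_filter]
    simp only [filter_mem_eq_inter, univ_inter]
    rw [sum_add_distrib, ← mul_sum]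
    rcases U.eq_empty_or_nonempty with rfl | hU
    · simp [surjNum]
    · obtain ⟨k, hk⟩ : ∃ k, U.card = k + 1 := ⟨U.card - 1, by have := card_pos.2 hU; omega⟩
      rw [sum_const, hk, surjNum, ← mul_sum]
      have : ∑ e ∈ U, Dv E h (k + 1 - 1) (U.erase e) (j + if clo E U e then 0 else 1) =
          (k + 1) * Dv E h (k + 1) U j := by
        rw [Dv]
        field_simp
        rfl
      rw [this]
      simp only [nsmul_eq_mul]
      push_cast
      ring

end abs

section conc
variable {n : ℕ}

/-- Expectation of a function of the number of edges. -/
noncomputable def Er (q : PMF (Finset (Sym2 (Fin n)))) (h : ℕ → ℝ) : ℝ :=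
  ∑ s, (q s).toReal * h s.card

lemma Er_pure (S : Finset (Sym2 (Fin n))) (h : ℕ → ℝ) : Er (PMF.pure S) h = h S.card := by
  unfold Er
  rw [sum_eq_single S]
  · simp
  · intro b _ hb
    simp [PMF.pure_apply, hb]
  · simp

lemma Er_one (q : PMF (Finset (Sym2 (Fin n)))) : Er q (fun _ => 1) = 1 := by
  unfold Er
  simp only [mul_one]
  have := q.tsum_coe
  rw [tsum_fintype] at this
  rw [← ENNReal.toReal_sum (fun a _ => q.apply_ne_top a), this]
  simp

lemma Er_bind (s : Finset (Sym2 (Fin n))) (hs : s.Nonempty)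
    (F : Sym2 (Fin n) → PMF (Finset (Sym2 (Fin n)))) (h : ℕ → ℝ) :
    Er ((PMF.uniformOfFinset s hs).bind F) h = (∑ e ∈ s, Er (F e) h) / s.card := by
  unfold Er
  have h1 : ∀ t, (((PMF.uniformOfFinset s hs).bind F) t).toReal =
      (∑ e ∈ s, ((F e) t).toReal) / s.card := by
    intro t
    rw [PMF.bind_apply, tsum_fintype, ENNReal.toReal_sum]
    · simp only [ENNReal.toReal_mul, PMF.uniformOfFinset_apply]
      rw [sum_div, ← sum_subset (subset_univ s)]
      · refine sum_congr rfl fun e he => ?_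
        simp [he]
        field_simp
      · intro e _ he
        simp [he]
    · intro e _
      exact ENNReal.mul_ne_top (PMF.apply_ne_top _ _) (PMF.apply_ne_top _ _)
  simp_rw [h1]
  rw [sum_comm, sum_div]
  refine sum_congr rfl fun t _ => ?_
  rw [← sum_mul, div_mul_eq_mul_div]

/-- Edges of the complete graph as a type. -/
abbrev Edg (n : ℕ) : Type := {e : Sym2 (Fin n) // e ∈ allEdges n}

variable {β : Type*} (H : SimpleGraph β)

/-- The copy of `H` given by an embedding. -/
noncomputable def cop (φ : β ↪ Fin n) : Finset (Edg n) :=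
  univ.filter fun e => ∃ a b, H.Adj a b ∧ e.1 = s(φ a, φ b)

lemma cop_edge (φ : β ↪ Fin n) {a b : β} (h : H.Adj a b) : s(φ a, φ b) ∈ allEdges n := by
  simp only [allEdges, mem_filter, mem_univ, true_and, Sym2.mk_isDiag_iff]
  exact fun h' => h.ne (φ.injective h')

lemma mem_removable (S : Finset (Sym2 (Fin n))) (x : Sym2 (Fin n)) :
    x ∈ removable H S ↔ copyAt H (↑S) x := by
  unfold removable
  rw [mem_filter]
  constructor
  · exact fun h => h.2
  · intro h
    refine ⟨?_, h⟩
    obtain ⟨φ, h1, a, b, hab, rfl⟩ := h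
    exact_mod_cast h1 a b hab

lemma removable_mono {S T : Finset (Sym2 (Fin n))} (h : S ⊆ T) :
    removable H S ⊆ removable H T := by
  intro x
  rw [mem_removable, mem_removable]
  rintro ⟨φ, h1, h2⟩
  exact ⟨φ, fun a b hab => by exact_mod_cast h (by exact_mod_cast h1 a b hab), h2⟩

lemma removable_subset (S : Finset (Sym2 (Fin n))) : removable H S ⊆ S :=
  filter_subset _ _

lemma reverse_Dv [Fintype β] (h : ℕ → ℝ) (k : ℕ) : ∀ (fuel : ℕ) (S : Finset (Sym2 (Fin n)))
    (U : Finset (Edg n)), U.card = k → (∀ e ∈ U, e.1 ∈ S) →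
    (∀ x ∈ removable H S, ∃ e ∈ U, e.1 = x) → k ≤ fuel →
    Er (reverseIter H fuel S) h = Dv (cop H) h k U (S.card - k) := by
  induction k with
  | zero =>
    intro fuel S U hU _ hR _
    have hU' : U = ∅ := card_eq_zero.1 hU
    have hne : ¬ (removable H S).Nonempty := by
      rintro ⟨x, hx⟩
      obtain ⟨e, he, _⟩ := hR x hx
      simp [hU'] at he
    have : reverseIter H fuel S = PMF.pure S := by
      cases fuel with
      | zero => rfl
      | succ f => rw [reverseIter, dif_neg hne]
    rw [this, Er_pure]
    rfl
  | succ k ih =>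
    intro fuel S U hU hUS hR hf
    obtain ⟨f, rfl⟩ : ∃ f, fuel = f + 1 := ⟨fuel - 1, by omega⟩
    have hcardS : k + 1 ≤ S.card := by
      rw [← hU, ← card_map (Function.Embedding.subtype _)]
      apply card_le_card
      intro x hx
      obtain ⟨e, he, rfl⟩ := mem_map.1 hx
      exact hUS e he
    have hclo : ∀ e ∈ U, clo (cop H) U e ↔ e.1 ∈ removable H S := by
      intro e he
      rw [mem_removable]
      constructor
      · rintro ⟨φ, h1, h2⟩
        refine ⟨φ, ?_, ?_⟩
        · intro a b hab
          have : (⟨_, cop_edge H φ hab⟩ : Edg n) ∈ cop H φ := by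
            simp only [cop, mem_filter, mem_univ, true_and]
            exact ⟨a, b, hab, rfl⟩
          exact_mod_cast hUS _ (h2 this)
        · simp only [cop, mem_filter, mem_univ, true_and] at h1
          exact h1
      · rintro ⟨φ, h1, h2⟩
        refine ⟨φ, ?_, ?_⟩
        · simp only [cop, mem_filter, mem_univ, true_and]
          exact h2
        · intro x hx
          simp only [cop, mem_filter, mem_univ, true_and] at hx
          have : x.1 ∈ removable H S := by
            rw [mem_removable]
            exact ⟨φ, h1, hx⟩
          obtain ⟨y, hy, hyx⟩ := hR _ this
          have : y = x := Subtype.ext hyx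
          rwa [← this]
    have hterm : ∀ e ∈ U, Dv (cop H) h k (U.erase e)
        (S.card - (k + 1) + if clo (cop H) U e then 0 else 1) =
        if e.1 ∈ removable H S then Er (reverseIter H f (S.erase e.1)) h
          else Er (reverseIter H (f + 1) S) h := by
      intro e he
      have hce : (U.erase e).card = k := by rw [card_erase_of_mem he, hU]; rfl
      by_cases hr : e.1 ∈ removable H S
      · rw [if_pos ((hclo e he).2 hr), if_pos hr, ih f (S.erase e.1) (U.erase e) hce]
        · rw [card_erase_of_mem (hUS e he)]
          congr 1
          omega
        · intro x hx
          rw [mem_erase] at hx ⊢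
          exact ⟨fun h' => hx.1 (Subtype.ext h'), hUS x hx.2⟩
        · intro x hx
          obtain ⟨y, hy, rfl⟩ := hR x (removable_mono H (erase_subset _ _) hx)
          refine ⟨y, mem_erase.2 ⟨?_, hy⟩, rfl⟩
          rintro rfl
          have := removable_subset H _ hx
          simp at this
        · omega
      · rw [if_neg (fun h' => hr ((hclo e he).1 h')), if_neg hr, ih (f + 1) S (U.erase e) hce]
        · congr 1
          omega
        · intro x hx
          exact hUS x (mem_of_mem_erase hx)
        · intro x hx
          obtain ⟨y, hy, rfl⟩ := hR x hx
          refine ⟨y, mem_erase.2 ⟨?_, hy⟩, rfl⟩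
          rintro rfl
          exact hr hx
        · omega
    have hDv : Dv (cop H) h (k + 1) U (S.card - (k + 1)) =
        (∑ e ∈ U, if e.1 ∈ removable H S then Er (reverseIter H f (S.erase e.1)) h
          else Er (reverseIter H (f + 1) S) h) / ((k : ℝ) + 1) := by
      rw [Dv]
      congr 1
      refine Finset.sum_congr rfl fun e he => ?_
      rw [← hterm e he]
      congr
      exact Subsingleton.elim _ _
    rw [hDv, eq_div_iff (by positivity)]
    have hsplit : (∑ e ∈ U, if e.1 ∈ removable H S then Er (reverseIter H f (S.erase e.1)) h
          else Er (reverseIter H (f + 1) S) h) =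
        ∑ e ∈ U, ((if e.1 ∈ removable H S then (Er (reverseIter H f (S.erase e.1)) h -
          Er (reverseIter H (f + 1) S) h) else 0) + Er (reverseIter H (f + 1) S) h) := by
      refine sum_congr rfl fun e _ => ?_
      split_ifs <;> ring
    rw [hsplit, sum_add_distrib, sum_const, hU]
    have hz : (∑ e ∈ U, if e.1 ∈ removable H S then (Er (reverseIter H f (S.erase e.1)) h -
          Er (reverseIter H (f + 1) S) h) else 0) = 0 := by
      have h1 : (∑ e ∈ U, if e.1 ∈ removable H S then (Er (reverseIter H f (S.erase e.1)) h -
          Er (reverseIter H (f + 1) S) h) else 0) =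
          ∑ x ∈ removable H S, (Er (reverseIter H f (S.erase x)) h -
            Er (reverseIter H (f + 1) S) h) := by
        rw [← sum_filter]
        refine sum_bij (fun e _ => e.1) ?_ ?_ ?_ ?_
        · intro e he; exact (mem_filter.1 he).2
        · intro e _ e' _ hee; exact Subtype.ext hee
        · intro x hx
          obtain ⟨y, hy, rfl⟩ := hR x hx
          exact ⟨y, mem_filter.2 ⟨hy, hx⟩, rfl⟩
        · intro e _; rfl
      rw [h1]
      by_cases hne : (removable H S).Nonempty
      · rw [sum_sub_distrib, sum_const, reverseIter, dif_pos hne, Er_bind, nsmul_eq_mul]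
        have : ((removable H S).card : ℝ) ≠ 0 := by
          exact_mod_cast (card_pos.2 hne).ne'
        field_simp
        ring
      · rw [not_nonempty_iff_eq_empty.1 hne]; simp
    rw [hz, zero_add, nsmul_eq_mul]
    push_cast
    ring

lemma reverse_final_Dv [Fintype β] (h : ℕ → ℝ) :
    Er (reverseFinal H n) h = Dv (cop H (n := n)) h (univ : Finset (Edg n)).card univ 0 := by
  unfold reverseFinal
  have hc : (univ : Finset (Edg n)).card = (allEdges n).card := by
    rw [card_univ, Fintype.card_coe]
  rw [reverse_Dv H h (univ : Finset (Edg n)).card _ _ univ rfl (fun e _ => e.2) ?_ hc.le, hc]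
  · simp
  · intro x hx
    exact ⟨⟨x, removable_subset H _ hx⟩, mem_univ _, rfl⟩

lemma Ex_surj [Fintype β] (h : ℕ → ℝ) (m : ℕ) :
    Ex m (fun ω : Fin m → Edg n => if rng ω = univ then h (cnt (cop H) ω) else 0) =
      Pr m (fun ω : Fin m → Edg n => rng ω = univ) * Er (reverseFinal H n) h := by
  have h1 := sum_surj (cop H (n := n)) h m univ 0
  have h2 := sum_surj (cop H (n := n)) (fun _ => 1) m univ 0
  rw [← reverse_final_Dv] at h1 h2
  rw [Er_one, mul_one] at h2
  rw [← h2] at h1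
  simp only [zero_add] at h1
  rw [Pr_def, Ex, Ex, h1]
  ring

open Filter Topology in
lemma Er_tendsto [Fintype β] [Nonempty (Edg n)] (h : ℕ → ℝ) :
    Tendsto (fun m => Ex m (fun ω : Fin m → Edg n => h (cnt (cop H) ω))) atTop
      (𝓝 (Er (reverseFinal H n) h)) := by
  have hN : (0 : ℝ) < Fintype.card (Edg n) := by exact_mod_cast Fintype.card_pos
  have hN1 : (1 : ℝ) ≤ Fintype.card (Edg n) := by exact_mod_cast Fintype.card_pos
  set N := Fintype.card (Edg n) with hNdef
  set B : ℝ := ∑ k ∈ range (N + 1), |h k| with hB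
  have hB' : ∀ k ≤ N, |h k| ≤ B := by
    intro k hk
    exact single_le_sum (f := fun k => |h k|) (fun _ _ => abs_nonneg _) (mem_range.2 (by omega))
  have hns : ∀ m, Pr m (fun ω : Fin m → Edg n => ¬ rng ω = univ) ≤ N * (1 - 1 / (N : ℝ)) ^ m := by
    intro m
    have h1 : Pr m (fun ω : Fin m → Edg n => ¬ rng ω = univ) ≤
        Pr m (fun ω : Fin m → Edg n => ∃ a, a ∉ rng ω) := by
      refine Pr_mono fun ω hω => ?_
      by_contra hcon
      push Not at hcon
      exact hω (eq_univ_of_forall hcon)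
    refine h1.trans ((Pr_exists _).trans ?_)
    refine (sum_le_card_nsmul _ _ _ fun a _ => Pr_notMem a m).trans ?_
    simp [hNdef]
  rw [tendsto_iff_norm_sub_tendsto_zero]
  have hlim : Tendsto (fun m : ℕ => (B + |Er (reverseFinal H n) h|) * (N * (1 - 1 / (N : ℝ)) ^ m))
      atTop (𝓝 0) := by
    have h1 : Tendsto (fun m : ℕ => (1 - 1 / (N : ℝ)) ^ m) atTop (𝓝 0) := by
      apply tendsto_pow_atTop_nhds_zero_of_lt_one
      · rw [sub_nonneg, div_le_one hN]; exact hN1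
      · have : 0 < 1 / (N : ℝ) := by positivity
        linarith
    simpa using (h1.const_mul (N : ℝ)).const_mul (B + |Er (reverseFinal H n) h|)
  refine squeeze_zero (fun m => norm_nonneg _) (fun m => ?_) hlim
  have hB0 : 0 ≤ B := (abs_nonneg _).trans (hB' 0 (by omega))
  refine le_trans ?_ (mul_le_mul_of_nonneg_left (hns m) (by positivity))
  rw [Real.norm_eq_abs]
  have h1 := Ex_surj H (n := n) h m
  have h2 := Pr_compl (m := m) (fun ω : Fin m → Edg n => rng ω = univ)
  have h3 : Ex m (fun ω : Fin m → Edg n => h (cnt (cop H) ω)) - Er (reverseFinal H n) h =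
      Ex m (fun ω : Fin m → Edg n => h (cnt (cop H) ω) -
        if rng ω = univ then h (cnt (cop H) ω) else 0) -
      Pr m (fun ω : Fin m → Edg n => ¬ rng ω = univ) * Er (reverseFinal H n) h := by
    rw [Ex_sub, h1, h2]; ring
  have h4 : |Ex m (fun ω : Fin m → Edg n => h (cnt (cop H) ω) -
        if rng ω = univ then h (cnt (cop H) ω) else 0)| ≤
      B * Pr m (fun ω : Fin m → Edg n => ¬ rng ω = univ) := by
    refine (Ex_abs _).trans ?_
    rw [Pr_def, ← Ex_mul]
    refine Ex_mono fun ω => ?_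
    by_cases hω : rng ω = univ
    · simp [hω]
    · simp only [hω, if_false, sub_zero, not_false_eq_true, if_true, mul_one]
      exact hB' _ (cnt_le_card (cop H) ω)
  rw [h3]
  refine (abs_sub _ _).trans ?_
  rw [abs_mul, abs_of_nonneg (Pr_nonneg _)]
  linarith

end conc
end Link

section Conc
set_option linter.unusedSectionVars false
open Finset
open scoped Classical

variable {β : Type*} [Fintype β] {H : SimpleGraph β}

lemma ncard_edge : H.edgeSet.ncard = H.edgeFinset.card := by
  rw [Set.ncard_eq_toFinset_card', SimpleGraph.edgeFinset]

lemma edge_choose (W : Finset β) (F : Finset (Sym2 β)) (hF : ∀ x ∈ F, x ∈ H.edgeSet)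
    (hW : ∀ x ∈ F, ∀ a ∈ x, a ∈ W) : F.card ≤ W.card.choose 2 := by
  rw [← Sym2.card_image_offDiag]
  apply card_le_card
  intro x hx
  induction x using Sym2.ind with
  | _ a b =>
    have h1 := hF _ hx
    rw [SimpleGraph.mem_edgeSet] at h1
    rw [mem_image]
    refine ⟨(a, b), ?_, rfl⟩
    rw [mem_offDiag]
    exact ⟨hW _ hx a (by simp), hW _ hx b (by simp), h1.ne⟩

lemma v_ge (hH : TwoBalanced H) : 3 ≤ Fintype.card β := by
  have h1 := edge_choose (H := H) univ H.edgeFinset (by simp) (by simp)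
  rw [← ncard_edge, card_univ] at h1
  have h2 := hH.1
  by_contra hcon
  have : (Fintype.card β).choose 2 ≤ (2).choose 2 := Nat.choose_le_choose 2 (by omega)
  simp at this
  omega

lemma d2_eq (hH : TwoBalanced H) :
    (H.edgeSet.ncard : ℝ) - 1 = d2 H * ((Fintype.card β : ℝ) - 2) := by
  unfold d2
  have : (3 : ℝ) ≤ Fintype.card β := by exact_mod_cast v_ge hH
  rw [div_mul_cancel₀]
  linarith

lemma d2_pos (hH : TwoBalanced H) : 0 < d2 H := by
  unfold d2
  have : (3 : ℝ) ≤ Fintype.card β := by exact_mod_cast v_ge hH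
  have : (2 : ℝ) ≤ H.edgeSet.ncard := by exact_mod_cast hH.1
  apply div_pos <;> linarith

lemma bal (hH : TwoBalanced H) (W : Finset β) (F : Finset (Sym2 β))
    (hF : ∀ x ∈ F, x ∈ H.edgeSet) (hW : ∀ x ∈ F, ∀ a ∈ x, a ∈ W) (hne : F.Nonempty) :
    (F.card : ℝ) - 1 ≤ d2 H * ((W.card : ℝ) - 2) := by
  have hc := edge_choose W F hF hW
  have hFc : 1 ≤ F.card := card_pos.2 hne
  by_cases h3 : 3 ≤ W.card
  · let G : H.Subgraph :=
      { verts := ↑W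
        Adj := fun a b => s(a, b) ∈ F
        adj_sub := fun {a b} h => hF _ h
        edge_vert := fun {a b} h => hW _ h a (by simp)
        symm := ⟨fun a b h => by rwa [Sym2.eq_swap]⟩ }
    have hv : G.verts.ncard = W.card := Set.ncard_coe_finset W
    have he : G.edgeSet = ↑F := by
      ext x
      induction x using Sym2.ind with
      | _ a b => simp [G]
    have hec : G.edgeSet.ncard = F.card := by rw [he, Set.ncard_coe_finset]
    by_cases hG : G = ⊤
    · have h1 : F.card = H.edgeSet.ncard := by rw [← hec, hG, SimpleGraph.Subgraph.edgeSet_top]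
      have h2 : W.card = Fintype.card β := by
        rw [← hv, hG, SimpleGraph.Subgraph.verts_top, Set.ncard_univ, Nat.card_eq_fintype_card]
      rw [h1, h2, d2_eq hH]
    · have := hH.2 G hG (by rw [hv]; exact h3)
      rw [hv, hec, div_le_iff₀] at this
      · exact this
      · have : (3 : ℝ) ≤ W.card := by exact_mod_cast h3
        linarith
  · have h2 : W.card = 2 := by
      by_contra h2
      have : W.card.choose 2 = 0 := Nat.choose_eq_zero_of_lt (by omega)
      omega
    rw [h2] at hc ⊢
    simp only [Nat.choose_self] at hc
    have : F.card = 1 := by omega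
    rw [this]; simp

lemma no_isolated (hH : TwoBalanced H) (b : β) : 0 < H.degree b := by
  by_contra hcon
  have h0 : H.degree b = 0 := by omega
  have hb : ∀ a, ¬ H.Adj b a := by
    intro a ha
    have := (H.degree_pos_iff_exists_adj b).2 ⟨a, ha⟩
    omega
  have hv := v_ge hH
  have h1 := bal hH (univ.erase b) H.edgeFinset (by simp) ?_ ?_
  · rw [card_erase_of_mem (mem_univ _), card_univ, ← ncard_edge, d2_eq hH,
      Nat.cast_sub (by omega)] at h1
    have := d2_pos hH
    push_cast at h1
    nlinarith
  · intro x hx a ha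
    rw [mem_erase]
    refine ⟨?_, mem_univ _⟩
    rintro rfl
    rw [SimpleGraph.mem_edgeFinset] at hx
    induction x using Sym2.ind with
    | _ c d =>
      rw [SimpleGraph.mem_edgeSet] at hx
      rcases Sym2.mem_iff.1 ha with rfl | rfl
      · exact hb _ hx
      · exact hb _ hx.symm
  · rw [← card_pos, ← ncard_edge]
    have := hH.1
    omega

lemma v_le (hH : TwoBalanced H) : Fintype.card β ≤ 2 * H.edgeSet.ncard := by
  rw [ncard_edge, ← SimpleGraph.sum_degrees_eq_twice_card_edges]
  calc Fintype.card β = ∑ _b : β, 1 := by simp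
    _ ≤ _ := sum_le_sum fun b _ => no_isolated hH b

lemma d2_ge (hH : TwoBalanced H) : 1 / 2 ≤ d2 H := by
  have h1 : (Fintype.card β : ℝ) ≤ 2 * H.edgeSet.ncard := by exact_mod_cast v_le hH
  have : (3 : ℝ) ≤ Fintype.card β := by exact_mod_cast v_ge hH
  unfold d2
  rw [le_div_iff₀] <;> linarith

variable {n : ℕ}

lemma cop_inter_card [DecidableEq (Edg n)] (φ : β ↪ Fin n) (U : Finset (Edg n)) :
    (cop H φ ∩ U).card =
      (H.edgeFinset.filter fun x => ∃ u ∈ U, u.1 = Sym2.map φ x).card := by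
  rw [← card_map (Function.Embedding.subtype _),
    ← card_image_of_injective _ (Sym2.map.injective φ.injective)]
  congr 1
  ext y
  simp only [mem_map, mem_inter, cop, mem_filter, mem_univ, true_and, mem_image,
    Function.Embedding.subtype_apply, SimpleGraph.mem_edgeFinset]
  constructor
  · rintro ⟨u, ⟨⟨a, b, hab, hu⟩, huU⟩, rfl⟩
    exact ⟨s(a, b), ⟨hab, u, huU, by rw [hu]; rfl⟩, by rw [hu]; rfl⟩
  · rintro ⟨x, ⟨hx, u, huU, hu⟩, rfl⟩
    refine ⟨u, ⟨?_, huU⟩, hu⟩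
    induction x using Sym2.ind with
    | _ a b => exact ⟨a, b, hx, hu⟩

lemma cop_card (φ : β ↪ Fin n) : (cop H φ).card = H.edgeSet.ncard := by
  have := cop_inter_card (H := H) φ univ
  rw [inter_univ] at this
  rw [this, ncard_edge]
  congr 1
  rw [filter_true_of_mem]
  intro x hx
  induction x using Sym2.ind with
  | _ a b =>
    rw [SimpleGraph.mem_edgeFinset] at hx
    exact ⟨⟨_, cop_edge H φ hx⟩, mem_univ _, rfl⟩

/-- Vertices spanned. -/
noncomputable def vspan (U : Finset (Edg n)) : Finset (Fin n) :=
  univ.filter fun u => ∃ e ∈ U, u ∈ e.1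

/-- Number of vertices spanned. -/
noncomputable def vsz (U : Finset (Edg n)) : ℕ := (vspan U).card

lemma vsz_empty : vsz (∅ : Finset (Edg n)) = 0 := by simp [vsz, vspan]

lemma vsz_single (g : Edg n) : vsz {g} ≤ 2 := by
  obtain ⟨g, hg⟩ := g
  induction g using Sym2.ind with
  | _ a b =>
    refine (card_le_card (t := {a, b}) ?_).trans card_le_two
    intro u hu
    simpa [vspan] using hu

lemma vsz_union [DecidableEq (Edg n)] (U : Finset (Edg n)) (φ : β ↪ Fin n) :
    vsz (U ∪ cop H φ) ≤ vsz U + Fintype.card β := by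
  have : vspan (U ∪ cop H φ) ⊆ vspan U ∪ univ.map φ := by
    intro u hu
    simp only [vspan, mem_filter, mem_univ, true_and, mem_union] at hu
    obtain ⟨e, he, hue⟩ := hu
    rw [mem_union]
    rcases he with he | he
    · left
      simp only [vspan, mem_filter, mem_univ, true_and]
      exact ⟨e, he, hue⟩
    · right
      simp only [cop, mem_filter, mem_univ, true_and] at he
      obtain ⟨a, b, _, hab⟩ := he
      rw [hab] at hue
      rw [mem_map]
      rcases Sym2.mem_iff.1 hue with rfl | rfl
      · exact ⟨a, mem_univ _, rfl⟩
      · exact ⟨b, mem_univ _, rfl⟩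
  refine (card_le_card this).trans ((card_union_le _ _).trans ?_)
  rw [card_map, card_univ]
  rfl

lemma cop_term [DecidableEq (Edg n)] (hH : TwoBalanced H) (hn : 1 ≤ n) (x : ℝ) (hx : 1 ≤ x) (U : Finset (Edg n))
    (φ : β ↪ Fin n) (hφ : ¬ Disjoint (cop H φ) U) :
    (x * (n : ℝ) ^ (-(1 / d2 H))) ^ (cop H φ \ U).card ≤
      x ^ H.edgeSet.ncard * ∏ b, (if φ b ∈ vspan U then (1 : ℝ) else 1 / n) := by
  have hd := d2_pos hH
  have hn' : (1 : ℝ) ≤ n := by exact_mod_cast hn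
  have hn0 : (0 : ℝ) < n := by linarith
  set F := H.edgeFinset.filter fun x => ∃ u ∈ U, u.1 = Sym2.map φ x with hF
  set W := (univ : Finset β).filter fun b => φ b ∈ vspan U with hW
  have hFc : (cop H φ ∩ U).card = F.card := cop_inter_card φ U
  have hb := bal hH W F ?_ ?_ ?_
  · have hsd : (cop H φ \ U).card + F.card = H.edgeSet.ncard := by
      rw [← hFc, card_sdiff_add_card_inter, cop_card]
    have hWc : (univ.filter fun b => φ b ∉ vspan U).card + W.card = Fintype.card β := by
      rw [add_comm, hW, card_filter_add_card_filter_not, card_univ]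
    have hprod : ∏ b, (if φ b ∈ vspan U then (1 : ℝ) else 1 / n) =
        (1 / (n : ℝ)) ^ (univ.filter fun b => φ b ∉ vspan U).card := by
      rw [prod_ite]
      simp
    rw [hprod, mul_pow]
    set k := (cop H φ \ U).card
    set l := (univ.filter fun b => φ b ∉ vspan U).card
    have hkl : d2 H * l ≤ k := by
      have h1 := d2_eq hH
      have h2 : (k : ℝ) + F.card = H.edgeSet.ncard := by exact_mod_cast hsd
      have h3 : (l : ℝ) + W.card = Fintype.card β := by exact_mod_cast hWc
      rw [← h2, ← h3] at h1
      nlinarith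
    gcongr
    · omega
    · rw [← Real.rpow_natCast, ← Real.rpow_mul hn0.le, one_div, one_div, inv_pow, ← Real.rpow_natCast,
        ← Real.rpow_neg hn0.le]
      apply Real.rpow_le_rpow_of_exponent_le hn'
      have : (l : ℝ) ≤ k / d2 H := by rw [le_div_iff₀ hd]; linarith
      have h2 : -(d2 H)⁻¹ * (k : ℝ) = - (k / d2 H) := by ring
      rw [h2]
      linarith
  · intro x hx
    rw [hF, mem_filter, SimpleGraph.mem_edgeFinset] at hx
    exact hx.1
  · intro x hx a ha
    rw [hF, mem_filter] at hx
    obtain ⟨_, u, hu, hux⟩ := hx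
    simp only [hW, vspan, mem_filter, mem_univ, true_and]
    refine ⟨u, hu, ?_⟩
    rw [hux, Sym2.mem_map]
    exact ⟨a, ha, rfl⟩
  · rw [← card_pos, ← hFc, card_pos]
    rwa [← not_disjoint_iff_nonempty_inter]

lemma cop_ext [DecidableEq (Edg n)] (hH : TwoBalanced H) (hn : 1 ≤ n) (x : ℝ) (hx : 1 ≤ x) (U : Finset (Edg n)) :
    ∑ φ ∈ univ.filter (fun φ : β ↪ Fin n => ¬ Disjoint (cop H φ) U),
      (x * (n : ℝ) ^ (-(1 / d2 H))) ^ (cop H φ \ U).card ≤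
      x ^ H.edgeSet.ncard * ((vsz U : ℝ) + 1) ^ Fintype.card β := by
  have hn0 : (0 : ℝ) < n := by exact_mod_cast hn
  have hx0 : 0 < x := by linarith
  set w : Fin n → ℝ := fun u => if u ∈ vspan U then (1 : ℝ) else 1 / n with hw
  have hw0 : ∀ u, 0 ≤ w u := by
    intro u; simp only [hw]; split_ifs <;> positivity
  have hsum : ∑ u, w u ≤ (vsz U : ℝ) + 1 := by
    have : ∀ u, w u ≤ (if u ∈ vspan U then (1 : ℝ) else 0) + 1 / n := by
      intro u; simp only [hw]
      have : 0 ≤ 1 / (n : ℝ) := by positivity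
      split_ifs <;> linarith
    refine (sum_le_sum fun u _ => this u).trans ?_
    rw [sum_add_distrib, sum_const, card_univ, Fintype.card_fin, nsmul_eq_mul,
      mul_one_div_cancel hn0.ne', ← sum_filter]
    simp [vsz]
  calc _ ≤ ∑ φ ∈ univ.filter (fun φ : β ↪ Fin n => ¬ Disjoint (cop H φ) U),
        x ^ H.edgeSet.ncard * ∏ b, w (φ b) :=
        sum_le_sum fun φ hφ => cop_term hH hn x hx U φ (mem_filter.1 hφ).2
    _ ≤ ∑ φ : β ↪ Fin n, x ^ H.edgeSet.ncard * ∏ b, w (φ b) :=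
        sum_le_sum_of_subset_of_nonneg (filter_subset _ _) fun φ _ _ =>
          mul_nonneg (by positivity) (prod_nonneg fun b _ => hw0 _)
    _ = x ^ H.edgeSet.ncard * ∑ φ : β ↪ Fin n, ∏ b, w (φ b) := by rw [mul_sum]
    _ ≤ x ^ H.edgeSet.ncard * ∑ f : β → Fin n, ∏ b, w (f b) := by
        gcongr
        rw [← sum_image (s := (univ : Finset (β ↪ Fin n))) (g := fun φ => (φ : β → Fin n))
          (f := fun f => ∏ b, w (f b))]
        · exact sum_le_sum_of_subset_of_nonneg (subset_univ _) fun φ _ _ =>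
            prod_nonneg fun b _ => hw0 _
        · intro a _ b _ hab
          exact DFunLike.coe_injective hab
    _ = x ^ H.edgeSet.ncard * (∑ u, w u) ^ Fintype.card β := by
        congr 1
        have := Finset.prod_univ_sum (fun _ : β => (univ : Finset (Fin n))) (fun _ u => w u)
        rw [Fintype.piFinset_univ] at this
        rw [← this, prod_const, card_univ]
    _ ≤ _ := by
        gcongr

lemma phi0 (hH : TwoBalanced H) (hn : 2 * Fintype.card β ≤ n) (g : Edg n) :
    ∃ Φ₀ : Finset (β ↪ Fin n), (∀ φ ∈ Φ₀, g ∈ cop H φ) ∧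
      ((n : ℝ) / 2) ^ (Fintype.card β - 2) ≤ Φ₀.card := by
  have hv := v_ge hH
  obtain ⟨g, hg⟩ := g
  induction g using Sym2.ind with
  | _ g1 g2 =>
  have hg12 : g1 ≠ g2 := by simpa [allEdges] using hg
  obtain ⟨z, hz⟩ : H.edgeFinset.Nonempty := by
    rw [← card_pos, ← ncard_edge]; have := hH.1; omega
  rw [SimpleGraph.mem_edgeFinset] at hz
  induction z using Sym2.ind with
  | _ a0 b0 =>
  rw [SimpleGraph.mem_edgeSet] at hz
  have hab : a0 ≠ b0 := hz.ne
  refine ⟨univ.filter fun φ => φ a0 = g1 ∧ φ b0 = g2, ?_, ?_⟩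
  · intro φ hφ
    rw [mem_filter] at hφ
    simp only [cop, mem_filter, mem_univ, true_and]
    exact ⟨a0, b0, hz, by rw [hφ.2.1, hφ.2.2]⟩
  let B := {b : β // ¬ (b = a0 ∨ b = b0)}
  let C := {u : Fin n // ¬ (u = g1 ∨ u = g2)}
  have hB : Fintype.card B = Fintype.card β - 2 := by
    rw [Fintype.card_subtype_compl, Fintype.card_subtype]
    congr 1
    have : (univ.filter fun b => b = a0 ∨ b = b0) = {a0, b0} := by ext; simp
    rw [this, card_pair hab]
  have hC : Fintype.card C = n - 2 := by
    rw [Fintype.card_subtype_compl, Fintype.card_subtype, Fintype.card_fin]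
    congr 1
    have : (univ.filter fun b => b = g1 ∨ b = g2) = {g1, g2} := by ext; simp
    rw [this, card_pair hg12]
  let fn : (B ↪ C) → β → Fin n := fun ψ b =>
    if h : b = a0 ∨ b = b0 then (if b = a0 then g1 else g2) else (ψ ⟨b, h⟩).1
  have fn1 : ∀ ψ, fn ψ a0 = g1 := by intro ψ; simp [fn]
  have fn2 : ∀ ψ, fn ψ b0 = g2 := by intro ψ; simp [fn, hab.symm]
  have fn3 : ∀ ψ b (h : ¬ (b = a0 ∨ b = b0)), fn ψ b = (ψ ⟨b, h⟩).1 := by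
    intro ψ b h; simp only [fn]; rw [dif_neg h]
  have hinj : ∀ ψ, Function.Injective (fn ψ) := by
    intro ψ b b' hbb
    by_cases h : b = a0 ∨ b = b0 <;> by_cases h' : b' = a0 ∨ b' = b0
    · rcases h with rfl | rfl <;> rcases h' with rfl | rfl <;>
        simp only [fn1, fn2] at hbb <;> first | rfl | (exact absurd hbb hg12) |
          (exact absurd hbb.symm hg12)
    · have := (ψ ⟨b', h'⟩).2
      rw [fn3 ψ b' h'] at hbb
      rcases h with rfl | rfl
      · rw [fn1] at hbb; exact absurd (Or.inl hbb.symm) this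
      · rw [fn2] at hbb; exact absurd (Or.inr hbb.symm) this
    · have := (ψ ⟨b, h⟩).2
      rw [fn3 ψ b h] at hbb
      rcases h' with rfl | rfl
      · rw [fn1] at hbb; exact absurd (Or.inl hbb) this
      · rw [fn2] at hbb; exact absurd (Or.inr hbb) this
    · rw [fn3 ψ b h, fn3 ψ b' h'] at hbb
      have := ψ.injective (Subtype.ext hbb)
      exact congrArg Subtype.val this
  have hcard : Fintype.card (B ↪ C) ≤
      (univ.filter fun φ : β ↪ Fin n => φ a0 = g1 ∧ φ b0 = g2).card := by
    rw [← card_univ]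
    refine card_le_card_of_injOn (fun ψ => ⟨fn ψ, hinj ψ⟩) ?_ ?_
    · intro ψ _
      simp [fn1, fn2]
    · intro ψ _ ψ' _ h
      have h' : fn ψ = fn ψ' := congrArg (fun φ : β ↪ Fin n => (φ : β → Fin n)) h
      ext b : 1
      apply Subtype.ext
      rw [← fn3 ψ b.1 b.2, ← fn3 ψ' b.1 b.2, h']
  rw [Fintype.card_embedding_eq, hB, hC] at hcard
  have h1 := (Nat.pow_sub_le_descFactorial (n - 2) (Fintype.card β - 2)).trans hcard
  refine le_trans ?_ (Nat.cast_le (α := ℝ).2 h1)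
  push_cast
  gcongr
  have h2 : n ≤ 2 * (n - 2 + 1 - (Fintype.card β - 2)) := by omega
  have h3 : (n : ℝ) ≤ 2 * ((n - 2 + 1 - (Fintype.card β - 2) : ℕ) : ℝ) := by exact_mod_cast h2
  linarith

end Conc

section Asy
set_option linter.unusedSectionVars false
open Finset
open scoped Classical

/-- Probability that `g` is not closed. -/
noncomputable def prNC {α : Type*} [Fintype α] {Φ : Type*} [Fintype Φ] (E : Φ → Finset α)
    (g : α) (m : ℕ) : ℝ := Pr m (fun ω => ¬ clo E (insert g (rng ω)) g)

lemma card_Edg (n : ℕ) : (Fintype.card (Edg n) : ℝ) = n * (n - 1) / 2 := by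
  have h1 : Fintype.card (Edg n) = n.choose 2 := by
    rw [Fintype.card_coe]
    have := Sym2.card_subtype_not_diag (α := Fin n)
    rw [Fintype.card_fin, Fintype.card_subtype] at this
    rw [← this]
    unfold allEdges
    congr
  rw [h1, Nat.cast_choose_two]

lemma card_Edg_ge {n : ℕ} (hn : 2 ≤ n) : (n : ℝ) ^ 2 / 4 ≤ Fintype.card (Edg n) := by
  rw [card_Edg]
  have : (2 : ℝ) ≤ n := by exact_mod_cast hn
  nlinarith

lemma card_Edg_le (n : ℕ) : (Fintype.card (Edg n) : ℝ) ≤ (n : ℝ) ^ 2 / 2 := by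
  rw [card_Edg]
  have : (0 : ℝ) ≤ n := by positivity
  nlinarith

lemma nonempty_Edg {n : ℕ} (hn : 2 ≤ n) : Nonempty (Edg n) := by
  rw [← Fintype.card_pos_iff]
  have h1 := card_Edg_ge hn
  have : (2 : ℝ) ≤ n := by exact_mod_cast hn
  have h2 : (0 : ℝ) < Fintype.card (Edg n) := by nlinarith
  exact_mod_cast h2

variable {β : Type*} [Fintype β] {H : SimpleGraph β}

/-- critical density -/
noncomputable def p1 (H : SimpleGraph β) (n : ℕ) : ℝ := (n : ℝ) ^ (-(1 / d2 H))

/-- order of magnitude -/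
noncomputable def yy (H : SimpleGraph β) (n : ℕ) : ℝ := (n : ℝ) ^ (2 - 1 / d2 H)

lemma p1_pos {n : ℕ} (hn : 2 ≤ n) : 0 < p1 H n := by
  have : (0 : ℝ) < n := by exact_mod_cast (by omega : 0 < n)
  exact Real.rpow_pos_of_pos this _

lemma yy_eq {n : ℕ} (hn : 2 ≤ n) : yy H n = (n : ℝ) ^ 2 * p1 H n := by
  have : (0 : ℝ) < n := by exact_mod_cast (by omega : 0 < n)
  unfold yy p1
  rw [sub_eq_add_neg, Real.rpow_add this]
  norm_num

lemma p1_le (hH : TwoBalanced H) {n : ℕ} (hn : 2 ≤ n) : p1 H n ≤ 1 := by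
  have : (1 : ℝ) ≤ n := by exact_mod_cast (by omega : 1 ≤ n)
  apply Real.rpow_le_one_of_one_le_of_nonpos this
  have := d2_pos hH
  have : 0 < 1 / d2 H := by positivity
  linarith

lemma yy_ge (hH : TwoBalanced H) {n : ℕ} (hn : 2 ≤ n) : 1 ≤ yy H n := by
  have : (1 : ℝ) ≤ n := by exact_mod_cast (by omega : 1 ≤ n)
  apply Real.one_le_rpow this
  have h2 := d2_ge hH
  have h3 : 1 / d2 H ≤ 2 := by
    rw [div_le_iff₀ (d2_pos hH)]; linarith
  linarith

lemma yy_le (hH : TwoBalanced H) {n : ℕ} (hn : 2 ≤ n) : yy H n ≤ (n : ℝ) ^ 2 := by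
  rw [yy_eq hn]
  have := p1_le hH hn
  have h2 : (0 : ℝ) ≤ (n : ℝ) ^ 2 := by positivity
  nlinarith

lemma yy_div {n : ℕ} (hn : 2 ≤ n) :
    yy H n / Fintype.card (Edg n) ≤ 4 * p1 H n := by
  have h1 := card_Edg_ge hn
  have hn' : (2 : ℝ) ≤ n := by exact_mod_cast hn
  have h2 : (0 : ℝ) < Fintype.card (Edg n) := by nlinarith
  rw [div_le_iff₀ h2, yy_eq hn]
  have := p1_pos (H := H) hn
  nlinarith

lemma yy_div_ge {n : ℕ} (hn : 2 ≤ n) :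
    2 * p1 H n ≤ yy H n / Fintype.card (Edg n) := by
  have h1 := card_Edg_ge hn
  have h3 := card_Edg_le n
  have hn' : (2 : ℝ) ≤ n := by exact_mod_cast hn
  have h2 : (0 : ℝ) < Fintype.card (Edg n) := by nlinarith
  rw [le_div_iff₀ h2, yy_eq hn]
  have := p1_pos (H := H) hn
  nlinarith

/-- block length -/
noncomputable def mm (H : SimpleGraph β) (n : ℕ) : ℕ := (H.edgeSet.ncard - 1) * ⌈yy H n⌉₊

lemma ceil_yy (hH : TwoBalanced H) {n : ℕ} (hn : 2 ≤ n) :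
    yy H n ≤ ⌈yy H n⌉₊ ∧ (⌈yy H n⌉₊ : ℝ) ≤ 2 * yy H n := by
  have h := yy_ge hH hn
  refine ⟨Nat.le_ceil _, ?_⟩
  have := Nat.ceil_lt_add_one (a := yy H n) (by linarith)
  linarith

lemma mm_le (hH : TwoBalanced H) {n : ℕ} (hn : 2 ≤ n) :
    (mm H n : ℝ) ≤ 2 * H.edgeSet.ncard * yy H n := by
  have h := (ceil_yy hH hn).2
  have h1 := yy_ge hH hn
  unfold mm
  push_cast
  have h2 : ((H.edgeSet.ncard - 1 : ℕ) : ℝ) ≤ H.edgeSet.ncard := by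
    exact_mod_cast Nat.sub_le _ _
  calc _ ≤ (H.edgeSet.ncard : ℝ) * (2 * yy H n) := by gcongr
    _ = _ := by ring

lemma mm_pos (hH : TwoBalanced H) {n : ℕ} (hn : 2 ≤ n) : 0 < mm H n := by
  have h1 := yy_ge hH hn
  have := hH.1
  unfold mm
  apply Nat.mul_pos (by omega)
  rw [Nat.ceil_pos]; linarith

set_option maxHeartbeats 1000000 in
lemma closed_const (hH : TwoBalanced H) : ∃ δ : ℝ, 0 < δ ∧ δ < 1 ∧
    ∀ n ≥ 2 * Fintype.card β, ∀ g : Edg n,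
      prNC (cop H) g (mm H n) ≤ 1 - δ := by
  have he := hH.1
  obtain ⟨e, hee⟩ : ∃ e, H.edgeSet.ncard = e + 1 := ⟨H.edgeSet.ncard - 1, by omega⟩
  have he1 : 1 ≤ e := by omega
  set v := Fintype.card β with hvdef
  have hv : 3 ≤ v := v_ge hH
  set x : ℝ := 8 * e with hx
  have hx1 : 1 ≤ x := by
    have : (1 : ℝ) ≤ e := by exact_mod_cast he1
    rw [hx]; linarith
  have hx0 : 0 < x := by linarith
  set D : ℝ := x ^ (e + 1) * ((v : ℝ) + 1) ^ v with hD
  have hD0 : 0 < D := by positivity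
  set δ : ℝ := (1 / 2) ^ (v - 2) * (1 / 2) ^ (2 * e) / (x ^ e * D) with hδ
  have hδ0 : 0 < δ := by positivity
  refine ⟨δ, hδ0, ?_, ?_⟩
  · rw [hδ, div_lt_one (by positivity)]
    have h1 : (1 / 2 : ℝ) ^ (v - 2) < 1 := pow_lt_one₀ (by norm_num) (by norm_num) (by omega)
    have h2 : (1 / 2 : ℝ) ^ (2 * e) < 1 := pow_lt_one₀ (by norm_num) (by norm_num) (by omega)
    have h3 : 1 ≤ x ^ e := one_le_pow₀ hx1
    have h4 : 1 ≤ D := by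
      have := one_le_pow₀ (n := e + 1) hx1
      have h5 : (1 : ℝ) ≤ ((v : ℝ) + 1) ^ v := one_le_pow₀ (by linarith [Nat.cast_nonneg (α := ℝ) v])
      rw [hD]; nlinarith
    have h5 : 0 < (1 / 2 : ℝ) ^ (2 * e) := by positivity
    nlinarith
  intro n hn g
  have hn2 : 2 ≤ n := by omega
  have := nonempty_Edg hn2
  have hp := p1_pos (H := H) hn2
  have hple := p1_le hH hn2
  have hN : (0 : ℝ) < Fintype.card (Edg n) := by exact_mod_cast Fintype.card_pos
  have hN1 : (1 : ℝ) ≤ Fintype.card (Edg n) := by exact_mod_cast Fintype.card_pos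
  obtain ⟨Φ₀, hΦ, hΦc⟩ := phi0 hH hn g
  have hnpos : (0 : ℝ) < n := by exact_mod_cast (by omega : 0 < n)
  have hcpos : (0 : ℝ) < Φ₀.card := lt_of_lt_of_le (by positivity) hΦc
  have hne : Φ₀.Nonempty := by
    rw [← card_pos]; exact_mod_cast hcpos
  obtain ⟨hc1, hc2⟩ := ceil_yy hH hn2
  have key := closed_lower (cop H (n := n)) g Φ₀ hΦ e (fun φ => by rw [cop_card, hee]) ⌈yy H n⌉₊
    (p1 H n / 2) (x * p1 H n) D (by positivity) ?_ ?_ ?_ hD0 (by positivity) hne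
  · have hm : mm H n = e * ⌈yy H n⌉₊ := by unfold mm; rw [hee]; rfl
    rw [prNC, hm, Pr_compl]
    have : δ ≤ (Φ₀.card : ℝ) * (p1 H n / 2) ^ (2 * e) / ((x * p1 H n) ^ e * D) := by
      have hpow : (n : ℝ) ^ (v - 2) * p1 H n ^ e = 1 := by
        unfold p1
        rw [← Real.rpow_natCast (n : ℝ), ← Real.rpow_natCast (_ ^ _), ← Real.rpow_mul hnpos.le,
          ← Real.rpow_add hnpos]
        have h1 := d2_eq hH
        have h2 : (e : ℝ) = d2 H * ((v : ℝ) - 2) := by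
          rw [← h1, hee]; push_cast; ring
        have h3 : ((v - 2 : ℕ) : ℝ) + -(1 / d2 H) * e = 0 := by
          rw [Nat.cast_sub (by omega), h2]
          have := (d2_pos hH).ne'
          field_simp
          push_cast
          ring
        rw [h3, Real.rpow_zero]
      rw [hδ]
      calc (1 / 2 : ℝ) ^ (v - 2) * (1 / 2) ^ (2 * e) / (x ^ e * D)
          = ((n : ℝ) / 2) ^ (v - 2) * (p1 H n / 2) ^ (2 * e) / ((x * p1 H n) ^ e * D) := by
            rw [mul_pow x (p1 H n) e, div_eq_div_iff (by positivity) (by positivity)]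
            rw [div_pow, div_pow, div_pow, div_pow]
            simp only [one_pow]
            have : p1 H n ^ (2 * e) = p1 H n ^ e * p1 H n ^ e := by ring
            rw [this]
            have h2 : (n : ℝ) ^ (v - 2) / 2 ^ (v - 2) * (p1 H n ^ e * p1 H n ^ e / 2 ^ (2 * e)) *
                (x ^ e * D) = ((n : ℝ) ^ (v - 2) * p1 H n ^ e) * (1 / 2 ^ (v - 2) * (p1 H n ^ e / 2 ^ (2 * e)) *
                (x ^ e * D)) := by ring
            rw [h2, hpow]
            ring
        _ ≤ _ := by gcongr
    linarith
  · -- q bound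
    have ht : 2 * p1 H n ≤ (⌈yy H n⌉₊ : ℝ) / Fintype.card (Edg n) :=
      (yy_div_ge (H := H) hn2).trans (by gcongr)
    set t := (⌈yy H n⌉₊ : ℝ) / Fintype.card (Edg n) with htdef
    have h1 : (1 - 1 / (Fintype.card (Edg n) : ℝ)) ^ ⌈yy H n⌉₊ ≤ Real.exp (-t) := by
      have h2 : 1 - 1 / (Fintype.card (Edg n) : ℝ) ≤ Real.exp (-(1 / (Fintype.card (Edg n) : ℝ))) := by
        have := Real.add_one_le_exp (-(1 / (Fintype.card (Edg n) : ℝ)))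
        linarith
      have h0 : 0 ≤ 1 - 1 / (Fintype.card (Edg n) : ℝ) := by
        rw [sub_nonneg, div_le_one hN]; exact hN1
      calc _ ≤ Real.exp (-(1 / (Fintype.card (Edg n) : ℝ))) ^ ⌈yy H n⌉₊ := by gcongr
        _ = _ := by
          rw [← Real.exp_nat_mul, htdef]; congr 1; ring
    have h3 : Real.exp (-t) ≤ 1 / (1 + 2 * p1 H n) := by
      rw [Real.exp_neg, ← one_div]
      apply one_div_le_one_div_of_le (by positivity)
      have := Real.add_one_le_exp t
      linarith
    have h4 : p1 H n / 2 ≤ 1 - 1 / (1 + 2 * p1 H n) := by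
      have : 1 - 1 / (1 + 2 * p1 H n) = 2 * p1 H n / (1 + 2 * p1 H n) := by field_simp; ring
      rw [this, le_div_iff₀ (by positivity)]
      nlinarith
    linarith
  · have h1 := yy_div (H := H) hn2
    push_cast
    rw [mul_div_assoc]
    have h2 : (⌈yy H n⌉₊ : ℝ) / Fintype.card (Edg n) ≤ 8 * p1 H n := by
      calc _ ≤ 2 * yy H n / Fintype.card (Edg n) := by gcongr
        _ = 2 * (yy H n / Fintype.card (Edg n)) := by ring
        _ ≤ _ := by linarith
    calc _ ≤ (e : ℝ) * (8 * p1 H n) := by gcongr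
      _ = _ := by rw [hx]; ring
  · intro φ hφ
    have h1 := @cop_ext _ _ H n (fun a b => Classical.propDecidable (a = b)) hH
      (by omega : 1 ≤ n) x hx1 (cop H φ)
    rw [← p1] at h1
    have h2 : vsz (cop H φ) ≤ v := by
      have := vsz_union (H := H) ∅ φ
      rwa [empty_union, vsz_empty, zero_add] at this
    refine le_trans ?_ (h1.trans ?_)
    · apply sum_le_sum_of_subset_of_nonneg
      · intro φ' hφ'
        refine (@mem_filter _ _ (_) _ _).2 ⟨mem_univ _, ?_⟩
        rw [not_disjoint_iff]
        exact ⟨g, hΦ φ' hφ', hΦ φ hφ⟩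
      · intros
        have : 0 ≤ x * p1 H n := by positivity
        exact pow_nonneg this _
    · rw [hD, hee]
      gcongr

lemma expEdges_eq (n : ℕ) : expEdges (reverseFinal H n) = Er (reverseFinal H n) (fun k => (k : ℝ)) := by
  unfold expEdges Er
  rw [tsum_fintype]

open Filter Topology in
lemma ec_tendsto {n : ℕ} (hn : 2 ≤ n) :
    Tendsto (fun m => ec (cop H (n := n)) m) atTop (𝓝 (expEdges (reverseFinal H n))) := by
  have := nonempty_Edg hn
  rw [expEdges_eq]
  exact Er_tendsto H (fun k => (k : ℝ))

lemma ec_le_exp {n : ℕ} (hn : 2 ≤ n) (m : ℕ) :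
    ec (cop H (n := n)) m ≤ expEdges (reverseFinal H n) := by
  have := nonempty_Edg hn
  refine ge_of_tendsto (ec_tendsto hn) ?_
  filter_upwards [Filter.eventually_ge_atTop m] with k hk
  obtain ⟨j, rfl⟩ := Nat.exists_eq_add_of_le hk
  exact ec_mono _ m j

lemma exp_tail {n : ℕ} (hn : 2 ≤ n) (m1 : ℕ) (hm1 : 0 < m1) (δ : ℝ) (hδ : 0 < δ)
    (h : ∀ g : Edg n, prNC (cop H) g m1 ≤ 1 - δ) (k : ℕ) :
    expEdges (reverseFinal H n) ≤ ec (cop H (n := n)) (k * m1) + m1 * (1 - δ) ^ k / δ := by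
  have := nonempty_Edg hn
  have h1 : Filter.Tendsto (fun j : ℕ => (k + j) * m1) Filter.atTop Filter.atTop := by
    refine Filter.tendsto_atTop_mono (f := fun j => j) (fun j => ?_) Filter.tendsto_id
    show j ≤ (k + j) * m1
    nlinarith
  refine le_of_tendsto ((ec_tendsto hn).comp h1) ?_
  filter_upwards with j
  have := ec_tail (cop H (n := n)) m1 (1 - δ) (by linarith) h j k
  simpa using this

lemma exp_upper (hH : TwoBalanced H) : ∃ A : ℝ, 0 < A ∧ ∀ n ≥ 2 * Fintype.card β,
    expEdges (reverseFinal H n) ≤ A * yy H n := by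
  obtain ⟨δ, hδ, _, h⟩ := closed_const hH
  have hv := v_ge hH
  have he := hH.1
  have he' : (0 : ℝ) < H.edgeSet.ncard := by exact_mod_cast (by omega : 0 < H.edgeSet.ncard)
  refine ⟨2 * H.edgeSet.ncard / δ, by positivity, fun n hn => ?_⟩
  have hn2 : 2 ≤ n := by omega
  have h1 := exp_tail hn2 (mm H n) (mm_pos hH hn2) δ hδ (h n hn) 0
  rw [zero_mul, ec_zero, pow_zero, zero_add, mul_one] at h1
  refine h1.trans ?_
  have := mm_le hH hn2
  calc _ ≤ 2 * H.edgeSet.ncard * yy H n / δ := by gcongr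
    _ = _ := by ring

lemma exp_lower (hH : TwoBalanced H) : ∃ a : ℝ, 0 < a ∧ ∀ n ≥ 2,
    a * yy H n ≤ expEdges (reverseFinal H n) := by
  have he := hH.1
  set v := Fintype.card β with hvdef
  set ε : ℝ := 1 / (8 * (1 + 3 ^ v)) with hε
  have hε0 : 0 < ε := by positivity
  have hε1 : 4 * ε * (1 + 3 ^ v) = 1 / 2 := by rw [hε]; field_simp; norm_num
  have h3v : (0 : ℝ) < 3 ^ v := by positivity
  have hε2 : 4 * ε ≤ 1 := by nlinarith
  refine ⟨ε / 2, by positivity, fun n hn => ?_⟩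
  have := nonempty_Edg hn
  have hN : (0 : ℝ) < Fintype.card (Edg n) := by exact_mod_cast Fintype.card_pos
  have hp := p1_pos (H := H) hn
  have hple := p1_le hH hn
  have hlow := ec_lower (cop H (n := n)) ⌈ε * yy H n⌉₊ (1 / 2) ?_
  · have h1 := ec_le_exp (H := H) hn ⌈ε * yy H n⌉₊
    have h2 := Nat.le_ceil (ε * yy H n)
    linarith
  intro i hi g
  let _ : DecidableEq (Edg n) := fun a b => Classical.propDecidable (a = b)
  rw [Nat.lt_ceil] at hi
  have h1 : (i : ℝ) / Fintype.card (Edg n) ≤ 4 * ε * p1 H n := by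
    calc _ ≤ ε * yy H n / Fintype.card (Edg n) := by gcongr
      _ = ε * (yy H n / Fintype.card (Edg n)) := by ring
      _ ≤ ε * (4 * p1 H n) := by gcongr; exact yy_div (H := H) hn
      _ = _ := by ring
  have h2 : ∑ φ with g ∈ cop H φ, ((i : ℝ) / Fintype.card (Edg n)) ^ ((cop H φ).erase g).card ≤
      4 * ε * 3 ^ v := by
    have h3 := cop_ext hH (by omega : 1 ≤ n) 1 le_rfl {g}
    have h4 : ∑ φ with g ∈ cop H φ, ((i : ℝ) / Fintype.card (Edg n)) ^ ((cop H φ).erase g).card ≤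
        ∑ φ ∈ univ.filter (fun φ : β ↪ Fin n => ¬ Disjoint (cop H φ) {g}),
          4 * ε * (1 * (n : ℝ) ^ (-(1 / d2 H))) ^ (cop H φ \ {g}).card := by
      have hfil : (univ.filter fun φ : β ↪ Fin n => g ∈ cop H φ) =
          univ.filter (fun φ : β ↪ Fin n => ¬ Disjoint (cop H φ) {g}) := by
        ext φ; simp
      rw [hfil]
      refine sum_le_sum fun φ hφ => ?_
      have hg : g ∈ cop H φ := by simpa using hφ
      have hsd : cop H φ \ {g} = (cop H φ).erase g := by rw [sdiff_singleton_eq_erase]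
      rw [hsd, one_mul]
      have hc : ((cop H φ).erase g).card = H.edgeSet.ncard - 1 := by
        rw [card_erase_of_mem hg, cop_card]
      rw [hc]
      calc _ ≤ (4 * ε * p1 H n) ^ (H.edgeSet.ncard - 1) := by gcongr
        _ = (4 * ε) ^ (H.edgeSet.ncard - 1) * p1 H n ^ (H.edgeSet.ncard - 1) := by rw [mul_pow]
        _ ≤ _ := by
          unfold p1
          gcongr
          exact pow_le_of_le_one (by positivity) hε2 (by omega)
    refine h4.trans ?_
    rw [← mul_sum]
    have h5 : (vsz {g} : ℝ) ≤ 2 := by exact_mod_cast vsz_single g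
    gcongr
    refine h3.trans ?_
    rw [one_pow, one_mul]
    gcongr
    linarith
  have h6 : 4 * ε * p1 H n ≤ 4 * ε := by nlinarith
  linarith

end Asy

section Final
set_option linter.unusedSectionVars false
open Finset
open scoped Classical

variable {β : Type*} [Fintype β] {H : SimpleGraph β}

lemma Er_transfer {n : ℕ} (hn : 2 ≤ n) (A : ℕ → Prop) (m0 : ℕ) (τ : ℝ)
    (hτ : expEdges (reverseFinal H n) - ec (cop H (n := n)) m0 ≤ τ) :
    Er (reverseFinal H n) (fun k => if A k then 1 else 0) ≤
      Pr m0 (fun ω : Fin m0 → Edg n => A (cnt (cop H) ω)) + τ := by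
  have := nonempty_Edg hn
  refine le_of_tendsto (Er_tendsto H (fun k => if A k then (1 : ℝ) else 0)) ?_
  filter_upwards [Filter.eventually_ge_atTop m0] with m hm
  obtain ⟨j, rfl⟩ := Nat.exists_eq_add_of_le hm
  have h1 := ec_le_exp (H := H) hn (m0 + j)
  have h2 : ec (cop H (n := n)) (m0 + j) =
      Ex m0 (fun ω : Fin m0 → Edg n => Ex j (fun ω' => (cnt (cop H) (Fin.append ω ω') : ℝ))) := by
    unfold ec; rw [Ex_append]
  have h3 : Ex (m0 + j) (fun ω : Fin (m0 + j) → Edg n => if A (cnt (cop H) ω) then (1 : ℝ) else 0) ≤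
      Pr m0 (fun ω : Fin m0 → Edg n => A (cnt (cop H) ω)) +
        (ec (cop H (n := n)) (m0 + j) - ec (cop H (n := n)) m0) := by
    rw [Ex_append, h2, Pr_def]
    unfold ec
    rw [← Ex_sub, ← Ex_add]
    refine Ex_mono fun ω => ?_
    have h4 : (if A (cnt (cop H) ω) then (1 : ℝ) else 0) +
        (Ex j (fun ω' => (cnt (cop H) (Fin.append ω ω') : ℝ)) - cnt (cop H) ω) =
        Ex j (fun ω' => (if A (cnt (cop H) ω) then (1 : ℝ) else 0) +
          ((cnt (cop H) (Fin.append ω ω') : ℝ) - cnt (cop H) ω)) := by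
      rw [Ex_add, Ex_sub, Ex_const, Ex_const]
    rw [h4]
    refine Ex_mono fun ω' => ?_
    have h5 := cnt_append_ge (cop H) ω ω'
    rcases h5.eq_or_lt with h6 | h6
    · rw [← h6]; simp
    · have h7 : (cnt (cop H) ω : ℝ) + 1 ≤ cnt (cop H) (Fin.append ω ω') := by exact_mod_cast h6
      split_ifs <;> linarith
  linarith

lemma prOf_ge {n : ℕ} (q : PMF (Finset (Sym2 (Fin n)))) (G : ℕ → Prop) :
    ENNReal.ofReal (1 - Er q (fun k => if ¬ G k then 1 else 0)) ≤ prOf q {s | G s.card} := by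
  have h1 : 1 - Er q (fun k => if ¬ G k then 1 else 0) = Er q (fun k => if G k then 1 else 0) := by
    have h0 : Er q (fun k => if ¬ G k then 1 else 0) + Er q (fun k => if G k then 1 else 0) =
        Er q (fun _ => 1) := by
      unfold Er
      rw [← sum_add_distrib]
      refine sum_congr rfl fun s _ => ?_
      by_cases h : G s.card <;> simp [h]
    rw [Er_one] at h0
    linarith
  rw [h1]
  unfold prOf Er
  rw [_root_.tsum_subtype, tsum_fintype, ENNReal.ofReal_sum_of_nonneg]
  · refine sum_le_sum fun s _ => ?_
    beta_reduce
    by_cases h : G s.card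
    · rw [if_pos h, mul_one, Set.indicator_of_mem (by exact h),
        ENNReal.ofReal_toReal (q.apply_ne_top s)]
    · rw [if_neg h]; simp
  · intro s _
    beta_reduce
    split_ifs <;> simp

lemma gamma_bad (hH : TwoBalanced H) {n : ℕ} (hn : 2 ≤ n) (m0 : ℕ) (x : ℝ) (hx : 1 ≤ x)
    (hm : (m0 : ℝ) / Fintype.card (Edg n) ≤ x * p1 H n) (k : ℕ) :
    Pr m0 (fun ω : Fin m0 → Edg n => ∃ g,
      Real.exp 1 * (x ^ H.edgeSet.ncard *
        (((2 + k * Fintype.card β : ℕ) : ℝ) + 1) ^ Fintype.card β) ≤ (xg (cop H) g ω : ℝ)) ≤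
      (n : ℝ) ^ 2 * Real.exp (-k) := by
  have := nonempty_Edg hn
  let _ : DecidableEq (Edg n) := fun a b => Classical.propDecidable (a = b)
  have hx0 : 0 < x := by linarith
  refine (Pr_exists _).trans ?_
  have key : ∀ g : Edg n, Pr m0 (fun ω : Fin m0 → Edg n => Real.exp 1 * (x ^ H.edgeSet.ncard *
        (((2 + k * Fintype.card β : ℕ) : ℝ) + 1) ^ Fintype.card β) ≤ (xg (cop H) g ω : ℝ)) ≤
        Real.exp (-k) := by
    intro g
    refine (moment_tail (cop H) g m0 (x * p1 H n) hm vsz (Fintype.card β) ?_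
      (fun s => x ^ H.edgeSet.ncard * ((s : ℝ) + 1) ^ Fintype.card β) ?_ ?_ ?_ k 2
      (vsz_single g) _ (by positivity)).trans ?_
    · intro U φ; exact vsz_union U φ
    · intro s t hst
      have : (s : ℝ) ≤ t := by exact_mod_cast hst
      show x ^ H.edgeSet.ncard * ((s : ℝ) + 1) ^ Fintype.card β ≤
        x ^ H.edgeSet.ncard * ((t : ℝ) + 1) ^ Fintype.card β
      gcongr
    · intro s; positivity
    · intro U
      exact cop_ext hH (by omega : 1 ≤ n) x hx U
    · rw [div_mul_eq_div_div_swap, div_self (by positivity), one_div, ← Real.exp_neg,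
        ← Real.exp_nat_mul]
      apply le_of_eq
      congr 1
      ring
  refine (sum_le_card_nsmul _ _ _ fun g _ => key g).trans ?_
  rw [card_univ, nsmul_eq_mul]
  have := card_Edg_le n
  gcongr
  have h2 : (0 : ℝ) ≤ (n : ℝ) ^ 2 := by positivity
  linarith

lemma dev_num (a c κ C2 C3 y EM L t m0 : ℝ) (e : ℕ) (he2 : 2 ≤ e) (ha : 0 < a) (hc : 0 < c)
    (hκ : 0 ≤ κ) (hC20 : 0 ≤ C2)
    (hC3 : C3 = C2 * Real.sqrt (8 * e * κ * (c + 2)) + 2)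
    (hL1 : 1 ≤ L) (h4 : C3 ≤ Real.sqrt a * L) (hy1 : 1 ≤ y)
    (hm0le : m0 ≤ 4 * e * κ * L * y)
    (ht : t ≤ (C2 * L ^ (3 * e)) * Real.sqrt (2 * m0 * ((c + 2) * L)))
    (hlow : a * y ≤ EM) : t + 2 ≤ Real.sqrt EM * L ^ (4 * e) := by
  have hL0 : 0 < L := by linarith
  have hsy : 1 ≤ Real.sqrt y := by rw [Real.one_le_sqrt]; exact hy1
  have ha1 : Real.sqrt (2 * m0 * ((c + 2) * L)) ≤
      Real.sqrt (8 * e * κ * (c + 2)) * L * Real.sqrt y := by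
    have : 2 * m0 * ((c + 2) * L) ≤ (8 * e * κ * (c + 2)) * L ^ 2 * y := by
      calc 2 * m0 * ((c + 2) * L) ≤ 2 * (4 * e * κ * L * y) * ((c + 2) * L) := by gcongr
        _ = _ := by ring
    refine (Real.sqrt_le_sqrt this).trans ?_
    rw [Real.sqrt_mul (by positivity), Real.sqrt_mul (by positivity), Real.sqrt_sq (by linarith)]
  have ha2 : t ≤ (C2 * L ^ (3 * e)) * (Real.sqrt (8 * e * κ * (c + 2)) * L * Real.sqrt y) :=
    ht.trans (mul_le_mul_of_nonneg_left ha1 (by positivity))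
  have ha3 : Real.sqrt a * Real.sqrt y ≤ Real.sqrt EM := by
    rw [← Real.sqrt_mul ha.le]
    exact Real.sqrt_le_sqrt hlow
  have hq : 1 ≤ L ^ (3 * e + 1) * Real.sqrt y :=
    one_le_mul_of_one_le_of_one_le (one_le_pow₀ hL1) hsy
  have hr : (C2 * L ^ (3 * e)) * (Real.sqrt (8 * e * κ * (c + 2)) * L * Real.sqrt y) =
      C2 * Real.sqrt (8 * e * κ * (c + 2)) * (L ^ (3 * e + 1) * Real.sqrt y) := by
    rw [pow_succ]; ring
  rw [hr] at ha2
  have ha4 : t + 2 ≤ C3 * (L ^ (3 * e + 1) * Real.sqrt y) := by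
    rw [hC3, add_mul]
    linarith
  refine ha4.trans ?_
  calc C3 * (L ^ (3 * e + 1) * Real.sqrt y)
      ≤ Real.sqrt a * L * (L ^ (3 * e + 1) * Real.sqrt y) :=
        mul_le_mul_of_nonneg_right h4 (by positivity)
    _ = (Real.sqrt a * Real.sqrt y) * L ^ (3 * e + 2) := by ring
    _ ≤ Real.sqrt EM * L ^ (4 * e) :=
        mul_le_mul ha3 (pow_le_pow_right₀ hL1 (by omega)) (by positivity) (by positivity)

set_option maxHeartbeats 4000000 in
lemma core (hH : TwoBalanced H) (δ a c κ σ C1 C2 C3 : ℝ) (e v : ℕ) (hδ0 : 0 < δ) (hδ1 : δ < 1)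
    (ha : 0 < a) (hc : 0 < c) (he : e = H.edgeSet.ncard) (hv : v = Fintype.card β)
    (hκ : κ = (c + 4) / δ) (hσ : σ = c + 10)
    (hC1 : C1 = Real.exp 1 * ((16 * e * κ) ^ e * (2 * σ * v + 3) ^ v))
    (hC2 : C2 = 2 + e * C1) (hC3 : C3 = C2 * Real.sqrt (8 * e * κ * (c + 2)) + 2)
    (n : ℕ) (hn4 : 4 ≤ n) (L : ℝ) (hL : L = Real.log n) (hL1 : 1 ≤ L)
    (h1 : 2 * e / δ ≤ n) (h2 : 4 * e * κ * L ≤ n) (h3 : C2 * L ^ (3 * e) ≤ n)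
    (h4 : C3 ≤ Real.sqrt a * L)
    (hcl : ∀ g : Edg n, prNC (cop H) g (mm H n) ≤ 1 - δ)
    (hlow : a * yy H n ≤ expEdges (reverseFinal H n)) :
    ENNReal.ofReal (1 - (n : ℝ) ^ (-c)) ≤
      prOf (reverseFinal H n) {s | |(s.card : ℝ) - expEdges (reverseFinal H n)| ≤
        Real.sqrt (expEdges (reverseFinal H n)) * Real.log n ^ (4 * H.edgeSet.ncard)} := by
  have hn2 : 2 ≤ n := by omega
  have := nonempty_Edg hn2
  have he2 : 2 ≤ e := he ▸ hH.1
  have heR : (2 : ℝ) ≤ e := by exact_mod_cast he2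
  have hv3 : 3 ≤ v := hv ▸ v_ge hH
  have hve : v ≤ 2 * e := by rw [hv, he]; exact v_le hH
  have hnR : (4 : ℝ) ≤ n := by exact_mod_cast hn4
  have hn0 : (0 : ℝ) < n := by linarith
  have hy1 := yy_ge hH hn2
  have hyn := yy_le hH hn2
  set y := yy H n with hy
  have hp := p1_pos (H := H) hn2
  have hκ4 : 4 ≤ κ := by
    rw [hκ, le_div_iff₀ hδ0]; linarith
  have hexpL : Real.exp L = n := by rw [hL, Real.exp_log hn0]
  set z := Real.exp (-L) with hz
  have hz0 : 0 < z := Real.exp_pos _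
  have hnz : (n : ℝ) * z = 1 := by rw [← hexpL, hz, ← Real.exp_add]; simp
  have hz4 : z ≤ 1 / 4 := by
    have := mul_le_mul_of_nonneg_right hnR hz0.le
    linarith
  set u := Real.exp (-(c * L)) with hu
  have hu0 : 0 < u := Real.exp_pos _
  have hu1 : u ≤ 1 := by
    rw [hu, Real.exp_le_one_iff]
    have : 0 < c * L := by positivity
    linarith
  have huz : ∀ j : ℕ, Real.exp (-((c + j) * L)) = u * z ^ j := by
    intro j
    rw [hu, hz, ← Real.exp_nat_mul, ← Real.exp_add]
    congr 1
    ring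
  -- block parameters
  set k0 := ⌈κ * L⌉₊ with hk0
  have hκL : 1 ≤ κ * L := one_le_mul_of_one_le_of_one_le (by linarith) hL1
  have hk0a : κ * L ≤ k0 := Nat.le_ceil _
  have hk0b : (k0 : ℝ) ≤ 2 * (κ * L) := by
    have := Nat.ceil_lt_add_one (a := κ * L) (by linarith)
    linarith
  have hmm := mm_le hH hn2
  have hmmpos := mm_pos hH hn2
  rw [← he] at hmm
  set m0 := k0 * mm H n with hm0
  have hm0pos : 0 < m0 := by
    apply Nat.mul_pos _ hmmpos
    rw [hk0, Nat.ceil_pos]; linarith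
  have hm0le : (m0 : ℝ) ≤ 4 * e * κ * L * y := by
    rw [hm0]
    push_cast
    calc (k0 : ℝ) * mm H n ≤ (2 * (κ * L)) * (2 * e * y) := by gcongr
      _ = _ := by ring
  -- tail
  set EM := expEdges (reverseFinal H n) with hEM
  have htail := exp_tail hn2 (mm H n) hmmpos δ hδ0 hcl k0
  rw [← hEM, ← hm0] at htail
  have hτ : (mm H n : ℝ) * (1 - δ) ^ k0 / δ ≤ u * z := by
    have ha1 : (1 - δ) ^ k0 ≤ u * z ^ 4 := by
      have hb : 1 - δ ≤ Real.exp (-δ) := by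
        have := Real.add_one_le_exp (-δ); linarith
      calc (1 - δ) ^ k0 ≤ Real.exp (-δ) ^ k0 := by
            apply pow_le_pow_left₀ (by linarith) hb
        _ = Real.exp (-(δ * k0)) := by rw [← Real.exp_nat_mul]; congr 1; ring
        _ ≤ Real.exp (-((c + (4 : ℕ)) * L)) := by
            rw [Real.exp_le_exp]
            have : δ * (κ * L) = (c + 4) * L := by rw [hκ]; field_simp
            have := mul_le_mul_of_nonneg_left hk0a hδ0.le
            push_cast
            linarith
        _ = _ := huz 4
    have ha0 : (0 : ℝ) ≤ (1 - δ) ^ k0 := pow_nonneg (by linarith) _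
    calc (mm H n : ℝ) * (1 - δ) ^ k0 / δ ≤ (2 * e * y) * (u * z ^ 4) / δ := by gcongr
      _ = (2 * e / δ) * y * (u * z ^ 4) := by ring
      _ ≤ n * (n : ℝ) ^ 2 * (u * z ^ 4) := by gcongr
      _ = (n * z) ^ 3 * (u * z) := by ring
      _ = u * z := by rw [hnz]; ring
  have hτ1 : u * z ≤ 1 := mul_le_one₀ hu1 hz0.le (by linarith)
  have hecle := ec_le_exp (H := H) hn2 m0
  rw [← hEM] at hecle
  -- typical event
  set x : ℝ := 16 * e * κ * L with hx
  have hx1 : 1 ≤ x := by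
    have ha1 : 1 ≤ (e : ℝ) * κ :=
      one_le_mul_of_one_le_of_one_le (by linarith) (by linarith)
    have ha2 : 1 ≤ (e : ℝ) * κ * L := one_le_mul_of_one_le_of_one_le ha1 hL1
    rw [hx]; linarith
  have hx0 : 0 < x := by linarith
  have hmN : (m0 : ℝ) / Fintype.card (Edg n) ≤ x * p1 H n := by
    have ha1 := yy_div (H := H) hn2
    have hN : (0 : ℝ) < Fintype.card (Edg n) := by exact_mod_cast Fintype.card_pos
    calc (m0 : ℝ) / Fintype.card (Edg n) ≤ 4 * e * κ * L * y / Fintype.card (Edg n) := by gcongr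
      _ = 4 * e * κ * L * (y / Fintype.card (Edg n)) := by ring
      _ ≤ 4 * e * κ * L * (4 * p1 H n) := by gcongr
      _ = _ := by rw [hx]; ring
  set k := ⌈σ * L⌉₊ with hk
  have hσ0 : 10 ≤ σ := by linarith
  have hσL : 1 ≤ σ * L := one_le_mul_of_one_le_of_one_le (by linarith) hL1
  have hka : σ * L ≤ k := Nat.le_ceil _
  have hkb : (k : ℝ) ≤ 2 * (σ * L) := by
    have := Nat.ceil_lt_add_one (a := σ * L) (by linarith)
    linarith
  have hgam := gamma_bad hH hn2 m0 x hx1 hmN k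
  rw [← he, ← hv] at hgam
  set lam : ℝ := Real.exp 1 * (x ^ e * (((2 + k * v : ℕ) : ℝ) + 1) ^ v) with hlam
  have hlam0 : 0 < lam := by positivity
  have hC10 : 0 < C1 := by rw [hC1]; positivity
  have hlamle : lam ≤ C1 * L ^ (3 * e) := by
    have ha1 : ((2 + k * v : ℕ) : ℝ) + 1 ≤ (2 * σ * v + 3) * L := by
      push_cast
      have : (k : ℝ) * v ≤ 2 * (σ * L) * v := by gcongr
      have hring : (2 * σ * v + 3) * L = 2 * (σ * L) * v + 3 * L := by ring
      rw [hring]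
      linarith
    calc lam ≤ Real.exp 1 * (x ^ e * ((2 * σ * v + 3) * L) ^ v) := by
          rw [hlam]; gcongr
      _ = C1 * L ^ (e + v) := by 
          rw [hx, hC1, mul_pow (16 * (e : ℝ) * κ) L e, mul_pow (2 * σ * (v : ℝ) + 3) L v, pow_add]
          ring
      _ ≤ C1 * L ^ (3 * e) := by
          gcongr
          omega
  set cc : ℝ := 2 + e * lam with hcc
  have hcc2 : 2 ≤ cc := by
    have : 0 ≤ (e : ℝ) * lam := by positivity
    linarith
  have hL3 : 1 ≤ L ^ (3 * e) := one_le_pow₀ hL1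
  have hccle : cc ≤ C2 * L ^ (3 * e) := by
    rw [hcc, hC2]
    have : (e : ℝ) * lam ≤ e * (C1 * L ^ (3 * e)) := by gcongr
    rw [add_mul, mul_assoc]
    linarith
  have hbad : Pr m0 (fun ω : Fin m0 → Edg n => ¬ ∀ g, (xg (cop H) g ω : ℝ) ≤ lam) ≤ u * z ^ 8 := by
    refine (Pr_mono (Q := fun ω => ∃ g, lam ≤ (xg (cop H) g ω : ℝ)) ?_).trans (hgam.trans ?_)
    · intro ω hω
      push Not at hω
      obtain ⟨g, hg⟩ := hω
      exact ⟨g, hg.le⟩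
    · have ha1 : Real.exp (-(k : ℝ)) ≤ u * z ^ 10 := by
        rw [← huz 10, Real.exp_le_exp]
        push_cast
        rw [← hσ]
        linarith
      calc (n : ℝ) ^ 2 * Real.exp (-(k : ℝ)) ≤ (n : ℝ) ^ 2 * (u * z ^ 10) := by gcongr
        _ = (n * z) ^ 2 * (u * z ^ 8) := by ring
        _ = _ := by rw [hnz]; ring
  have hNle : (Fintype.card (Edg n) : ℝ) ≤ (n : ℝ) ^ 2 := by
    have ha1 := card_Edg_le n
    have ha2 : (0 : ℝ) ≤ (n : ℝ) ^ 2 := by positivity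
    linarith
  have hΓ1 : ((Fintype.card (Edg n) : ℝ) + cc * m0) *
      Pr m0 (fun ω : Fin m0 → Edg n => ¬ ∀ g, (xg (cop H) g ω : ℝ) ≤ lam) ≤ 1 := by
    have ha1 : cc * m0 ≤ n * (n * (n : ℝ) ^ 2) := by
      have : (m0 : ℝ) ≤ n * (n : ℝ) ^ 2 := by
        refine hm0le.trans ?_
        gcongr
      have hccn : cc ≤ n := hccle.trans h3
      gcongr
    calc _ ≤ ((n : ℝ) ^ 2 + n * (n * (n : ℝ) ^ 2)) * (u * z ^ 8) := by
          gcongr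
          exact Pr_nonneg _
      _ = u * ((n * z) ^ 2 * z ^ 6 + (n * z) ^ 4 * z ^ 4) := by ring
      _ = u * (z ^ 6 + z ^ 4) := by rw [hnz]; ring
      _ ≤ 1 * ((1 / 4) ^ 6 + (1 / 4) ^ 4) := by gcongr
      _ ≤ 1 := by norm_num
  have hΓ2 : ∃ ω : Fin m0 → Edg n, ∀ g, (xg (cop H) g ω : ℝ) ≤ lam := by
    by_contra hcon
    push Not at hcon
    have ha1 : Pr m0 (fun ω : Fin m0 → Edg n => ¬ ∀ g, (xg (cop H) g ω : ℝ) ≤ lam) = 1 := by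
      have : ∀ ω : Fin m0 → Edg n, ¬ ∀ g, (xg (cop H) g ω : ℝ) ≤ lam := by
        intro ω hω
        obtain ⟨g, hg⟩ := hcon ω
        exact absurd (hω g) (not_le.2 hg)
      rw [Pr_def]
      simp only [this, not_false_eq_true, if_true]
      exact Ex_const 1
    rw [ha1] at hbad
    have : u * z ^ 8 ≤ 1 * (1 / 4) ^ 8 := by gcongr
    norm_num at this
    linarith
  -- deviation
  set t : ℝ := cc * Real.sqrt (2 * m0 * ((c + 2) * L)) with ht
  have ht0 : 0 ≤ t := by positivity
  have hm0R : (0 : ℝ) < m0 := by exact_mod_cast hm0pos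
  have hmc := typical_mcdiarmid cc (by linarith) m0 hm0pos
    (fun ω : Fin m0 → Edg n => (cnt (cop H) ω : ℝ))
    (fun ω => ∀ g, (xg (cop H) g ω : ℝ) ≤ lam) (Fintype.card (Edg n))
    (fun ω => ⟨by positivity, by exact_mod_cast cnt_le_card (cop H) ω⟩)
    (fun ω ω' hω' => cnt_lip (cop H) ω ω' e (fun φ => by rw [cop_card, he]) lam hω')
    t ht0 hΓ1 hΓ2
  have hexp : Real.exp (-(t ^ 2 / (2 * m0 * cc ^ 2))) = u * z ^ 2 := by
    rw [← huz 2, ht, mul_pow, Real.sq_sqrt (by positivity)]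
    congr 2
    have : cc ≠ 0 := by linarith
    push_cast
    field_simp
  rw [hexp] at hmc
  set T : ℝ := Real.sqrt EM * Real.log n ^ (4 * H.edgeSet.ncard) with hT
  have hTge : t + 2 ≤ T := by
    have ha2 : t ≤ (C2 * L ^ (3 * e)) * Real.sqrt (2 * m0 * ((c + 2) * L)) := by
      rw [ht]; exact mul_le_mul_of_nonneg_right hccle (Real.sqrt_nonneg _)
    have hC20 : 0 ≤ C2 := by rw [hC2]; positivity
    have := dev_num a c κ C2 C3 y EM L t m0 e he2 ha hc (by linarith) hC20 hC3 hL1 h4 hy1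
      hm0le ha2 hlow
    rw [hT, ← hL, ← he]
    exact this
  -- conclusion
  have hpr := prOf_ge (reverseFinal H n) (fun k => |(k : ℝ) - EM| ≤ T)
  refine le_trans (ENNReal.ofReal_le_ofReal ?_) hpr
  have htr := Er_transfer (H := H) hn2 (fun k => ¬ |(k : ℝ) - EM| ≤ T) m0 (u * z)
    (by rw [← hEM]; linarith)
  have hpm : Pr m0 (fun ω : Fin m0 → Edg n => ¬ |(cnt (cop H) ω : ℝ) - EM| ≤ T) ≤
      Pr m0 (fun ω : Fin m0 → Edg n => t + 1 ≤ |(cnt (cop H) ω : ℝ) -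
        Ex m0 (fun ω : Fin m0 → Edg n => (cnt (cop H) ω : ℝ))|) := by
    refine Pr_mono fun ω hω => ?_
    rw [not_le] at hω
    have hab : |(cnt (cop H) ω : ℝ) - EM| ≤ |(cnt (cop H) ω : ℝ) - ec (cop H (n := n)) m0| +
        |ec (cop H (n := n)) m0 - EM| := abs_sub_le _ _ _
    have hab2 : |ec (cop H (n := n)) m0 - EM| ≤ u * z := by
      have huz0 := mul_pos hu0 hz0
      rw [abs_le]; constructor <;> linarith
    have hab3 : t + 1 ≤ |(cnt (cop H) ω : ℝ) - ec (cop H (n := n)) m0| := by linarith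
    exact hab3
  have hnc : (n : ℝ) ^ (-c) = u := by
    rw [Real.rpow_def_of_pos hn0, ← hL, hu]
    congr 1
    ring
  rw [hnc]
  have hfin : 2 * (u * z ^ 2) + u * z ^ 8 + u * z ≤ u := by
    have hf1 : z ^ 2 ≤ (1 / 4) ^ 2 := by gcongr
    have hf2 : z ^ 8 ≤ (1 / 4) ^ 8 := by gcongr
    have : u * (2 * z ^ 2 + z ^ 8 + z) ≤ u * 1 := by
      gcongr
      norm_num at hf1 hf2
      linarith
    linarith
  have hX := htr.trans (by linarith : _ + u * z ≤ u)
  refine sub_le_sub_left (le_trans (le_of_eq ?_) hX) 1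
  congr!

end Final

section
open Filter

/-- **Final number of edges in the reverse `H`-free process** (Theorem 1.15 of Warnke).
For a 2-balanced graph `H` there are constants `a, A > 0` with
`a n^{2-1/d₂(H)} ≤ E M_n ≤ A n^{2-1/d₂(H)}`, and for every `c > 0` and all large `n`,
`|M_n - E M_n| ≤ √(E M_n) (log n)^{4 e_H}` holds with probability at least `1 - n^{-c}`. -/
theorem reverse_H_free_final_edges {β : Type*} [Fintype β] (H : SimpleGraph β)
    (hH : TwoBalanced H) :
    ∃ a A : ℝ, 0 < a ∧ 0 < A ∧
      (∃ n₀ : ℕ, ∀ n ≥ n₀,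
        a * (n : ℝ) ^ (2 - 1 / d2 H) ≤ expEdges (reverseFinal H n) ∧
        expEdges (reverseFinal H n) ≤ A * (n : ℝ) ^ (2 - 1 / d2 H)) ∧
      ∀ c : ℝ, 0 < c → ∃ n₀ : ℕ, ∀ n ≥ n₀,
        ENNReal.ofReal (1 - (n : ℝ) ^ (-c)) ≤
          prOf (reverseFinal H n)
            {s | |(s.card : ℝ) - expEdges (reverseFinal H n)| ≤
              Real.sqrt (expEdges (reverseFinal H n)) *
                Real.log n ^ (4 * H.edgeSet.ncard)} := by
  obtain ⟨a, ha, hlow⟩ := exp_lower hH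
  obtain ⟨A, hA, hup⟩ := exp_upper hH
  obtain ⟨δ, hδ0, hδ1, hcl⟩ := closed_const hH
  have hv := v_ge hH
  refine ⟨a, A, ha, hA, ⟨2 * Fintype.card β, fun n hn => ⟨hlow n (by omega), hup n hn⟩⟩, ?_⟩
  intro c hc
  set e := H.edgeSet.ncard with he
  set κ := (c + 4) / δ with hκ
  set σ := c + 10 with hσ
  set C1 : ℝ := Real.exp 1 *
    ((16 * e * κ) ^ e * (2 * σ * (Fintype.card β : ℝ) + 3) ^ Fintype.card β) with hC1
  set C2 := 2 + e * C1 with hC2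
  set C3 := C2 * Real.sqrt (8 * e * κ * (c + 2)) + 2 with hC3
  have hcast : Tendsto (fun n : ℕ => (n : ℝ)) atTop atTop := tendsto_natCast_atTop_atTop
  have hlog : Tendsto (fun n : ℕ => Real.log n) atTop atTop := Real.tendsto_log_atTop.comp hcast
  have hlit : ∀ (C : ℝ) (j : ℕ), ∀ᶠ n : ℕ in atTop, C * Real.log n ^ j ≤ n := by
    intro C j
    have h1 := (Real.isLittleO_pow_log_id_atTop (n := j)).const_mul_left C
    have h2 := hcast.eventually (h1.bound (c := 1) one_pos)
    filter_upwards [h2] with n hn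
    simp only [id, one_mul, Real.norm_eq_abs, Nat.abs_cast] at hn
    exact (le_abs_self _).trans hn
  have hsa : 0 < Real.sqrt a := Real.sqrt_pos.2 ha
  have hall : ∀ᶠ n : ℕ in atTop, 4 ≤ n ∧ 2 * Fintype.card β ≤ n ∧ 1 ≤ Real.log n ∧
      2 * e / δ ≤ n ∧ 4 * e * κ * Real.log n ^ 1 ≤ n ∧ C2 * Real.log n ^ (3 * e) ≤ n ∧
      C3 ≤ Real.sqrt a * Real.log n := by
    filter_upwards [eventually_ge_atTop 4, eventually_ge_atTop (2 * Fintype.card β),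
      hlog.eventually_ge_atTop 1, hcast.eventually_ge_atTop (2 * e / δ),
      hlit (4 * e * κ) 1, hlit C2 (3 * e),
      (hlog.const_mul_atTop hsa).eventually_ge_atTop C3] with n h1 h2 h3 h4 h5 h6 h7
    exact ⟨h1, h2, h3, h4, h5, h6, h7⟩
  obtain ⟨n₀, hn₀⟩ := eventually_atTop.1 hall
  refine ⟨n₀, fun n hn => ?_⟩
  obtain ⟨h1, h2, h3, h4, h5, h6, h7⟩ := hn₀ n hn
  exact core hH δ a c κ σ C1 C2 C3 e (Fintype.card β) hδ0 hδ1 ha hc he rfl hκ hσ hC1 hC2 hC3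
    n h1 _ rfl h3 h4 (by simpa using h5) h6 h7 (hcl n h2) (hlow n (by omega))

end
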